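/- arXiv:2506.17737 — 2 statements merged into one kernel-verified Lean document; each statement's English description precedes it below -/
import Mathlib

section
/- For each k ≥ 1 and each a ∈ (1/2, 1), setting β := 1/a, one has dim_H D^{+∞}_{k,a} = dim_H D^{−∞}_{k,a} = (log β / log 3)·dim_H 𝒰_β, where 𝒰_β is the set of points in [0, 1/(β−1)] having a unique β-expansion with digits in {0,1}. -/
open Filter Topology MeasureTheory Set
open scoped ENNReal

/-- The `(n+1)`-th ternary digit of `x` (choosing the expansion ending in all `0`s
when two expansions exist, and the all-`2`s expansion for `x = 1`). -/
noncomputable def tDigit (x : ℝ) (n : ℕ) : ℕ :=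
  if x = 1 then 2 else (⌊(3:ℝ) ^ (n + 1) * x⌋ - 3 * ⌊(3:ℝ) ^ n * x⌋).toNat

/-- `l_n(x)`: the number of `1`s among the first `n` ternary digits of `x`. -/
noncomputable def lCount (x : ℝ) (n : ℕ) : ℕ :=
  ((Finset.range n).filter (fun i => tDigit x i = 1)).card

/-- `q_a(d)` with `q_a(0)=0`, `q_a(1)=a`, `q_a(2)=1-a`. -/
noncomputable def qDig (a : ℝ) (d : ℕ) : ℝ :=
  if d = 0 then 0 else if d = 1 then a else 1 - a

/-- Okamoto's function `F_a`. -/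
noncomputable def Okamoto (a x : ℝ) : ℝ :=
  ∑' n : ℕ, a ^ (n - lCount x n) * (1 - 2 * a) ^ lCount x n * qDig a (tDigit x n)

/-- `M_{k,a}(x)`: the `k`-th partial derivative of `F_a(x)` with respect to `a`. -/
noncomputable def Mfun (k : ℕ) (a x : ℝ) : ℝ :=
  iteratedDeriv k (fun b => Okamoto b x) a

/-- `f` has derivative `+∞` at `x` (difference quotients over `y ∈ [0,1] \ {x}`). -/
def derivPInf (f : ℝ → ℝ) (x : ℝ) : Prop :=
  Tendsto (fun y => (f y - f x) / (y - x)) (𝓝[Set.Icc 0 1 \ {x}] x) atTop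

/-- `f` has derivative `-∞` at `x`. -/
def derivMInf (f : ℝ → ℝ) (x : ℝ) : Prop :=
  Tendsto (fun y => (f y - f x) / (y - x)) (𝓝[Set.Icc 0 1 \ {x}] x) atBot

noncomputable def phiOk (a : ℝ) : ℝ :=
  if a = 1/3 then 1/3 else if a = 1/2 then 0
  else Real.log (3 * a) / (Real.log a - Real.log |1 - 2 * a|)

noncomputable def C0 (a : ℝ) : ℝ := 1 / (Real.log a - Real.log |1 - 2 * a|)

noncomputable def hEnt (p : ℝ) : ℝ :=
  (-(p * Real.log p) - (1 - p) * Real.log (1 - p) + (1 - p) * Real.log 2) / Real.log 3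

noncomputable def dOk (a : ℝ) : ℝ := hEnt (phiOk a)

noncomputable def dTilde (a : ℝ) : ℝ := hEnt (1 - 2 * a)

/-- `(c_n)` is a `β`-expansion of `y` with digits in `{0,1}` (digits indexed from `1`,
i.e. `c n` is the coefficient of `β^{-(n+1)}`). -/
def IsBetaExp (β y : ℝ) (c : ℕ → ℕ) : Prop :=
  (∀ n, c n ≤ 1) ∧ y = ∑' n : ℕ, (c n : ℝ) / β ^ (n + 1)

/-- The univoque set `𝒰_β` of points of `[0, 1/(β-1)]` with a unique `β`-expansion. -/
def univoque (β : ℝ) : Set ℝ :=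
  {y ∈ Set.Icc (0:ℝ) (1 / (β - 1)) | ∃! c : ℕ → ℕ, IsBetaExp β y c}

namespace SignSeq

/-- The sign `±1` attached to a binary digit. -/
def sgn (b : Bool) : ℝ := if b then 1 else -1

/-- The value `∑ ± ρ ^ (n + 1)` of a sign sequence. -/
noncomputable def val (ρ : ℝ) (c : ℕ → Bool) : ℝ := ∑' n, sgn (c n) * ρ ^ (n + 1)

/-- The sequence with its first `n` entries dropped. -/
def shift (n : ℕ) (c : ℕ → Bool) : ℕ → Bool := fun i => c (n + i)

/-- The pointwise negation of a sequence. -/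
def neg (c : ℕ → Bool) : ℕ → Bool := fun i => !(c i)

/-- Strict lexicographic order. -/
def Lt (c d : ℕ → Bool) : Prop := ∃ n, (∀ i < n, c i = d i) ∧ c n = false ∧ d n = true

@[simp] lemma sgn_true : sgn true = 1 := rfl
@[simp] lemma sgn_false : sgn false = -1 := rfl
@[simp] lemma sgn_not (b : Bool) : sgn (!b) = -sgn b := by cases b <;> simp
@[simp] lemma abs_sgn (b : Bool) : |sgn b| = 1 := by cases b <;> simp

@[simp] lemma shift_zero (c : ℕ → Bool) : shift 0 c = c := by ext i; simp [shift]

lemma shift_shift (m n : ℕ) (c : ℕ → Bool) : shift m (shift n c) = shift (n + m) c := by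
  ext i; simp [shift, add_assoc]

lemma shift_neg (n : ℕ) (c : ℕ → Bool) : shift n (neg c) = neg (shift n c) := rfl

lemma lt_trichotomy (c d : ℕ → Bool) : c = d ∨ Lt c d ∨ Lt d c := by
  by_cases h : c = d
  · exact Or.inl h
  · right
    have hex : ∃ n, c n ≠ d n := by
      by_contra! hc
      exact h (funext hc)
    classical
    have hmin : ∀ i < Nat.find hex, c i = d i := fun i hi => by
      simpa using Nat.find_min hex hi
    have hne := Nat.find_spec hex
    cases hc : c (Nat.find hex)
    · left
      refine ⟨_, hmin, hc, ?_⟩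
      simpa [hc] using hne
    · right
      refine ⟨_, fun i hi => (hmin i hi).symm, ?_, hc⟩
      simpa [hc] using hne

variable {ρ : ℝ}

lemma summable_val (h0 : 0 < ρ) (h1 : ρ < 1) (c : ℕ → Bool) :
    Summable fun n => sgn (c n) * ρ ^ (n + 1) := by
  refine Summable.of_norm_bounded (g := fun n => ρ ^ (n + 1)) ?_ fun n => ?_
  · exact (summable_nat_add_iff 1).2 (summable_geometric_of_lt_one h0.le h1)
  · rw [norm_mul, Real.norm_eq_abs, abs_sgn, one_mul, Real.norm_eq_abs, abs_of_pos (by positivity)]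

lemma val_step (h0 : 0 < ρ) (h1 : ρ < 1) (c : ℕ → Bool) :
    val ρ c = ρ * (sgn (c 0) + val ρ (shift 1 c)) := by
  rw [val, (summable_val h0 h1 c).tsum_eq_zero_add, val, mul_add, ← tsum_mul_left]
  congr 1
  · ring
  · refine tsum_congr fun n => ?_
    simp only [shift, add_comm 1 n]
    ring

lemma val_shift_step (h0 : 0 < ρ) (h1 : ρ < 1) (c : ℕ → Bool) (n : ℕ) :
    val ρ (shift n c) = ρ * (sgn (c n) + val ρ (shift (n + 1) c)) := by
  rw [val_step h0 h1, shift_shift]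
  simp [shift]

lemma val_split (h0 : 0 < ρ) (h1 : ρ < 1) (c : ℕ → Bool) (n : ℕ) :
    val ρ c = ∑ i ∈ Finset.range n, sgn (c i) * ρ ^ (i + 1) + ρ ^ n * val ρ (shift n c) := by
  induction n with
  | zero => simp
  | succ n ih =>
    rw [ih, Finset.sum_range_succ, val_shift_step h0 h1 c n]
    ring

@[simp] lemma val_neg (c : ℕ → Bool) : val ρ (neg c) = -val ρ c := by
  rw [val, val, ← tsum_neg]
  exact tsum_congr fun n => by simp [neg]

lemma abs_val_le (h0 : 0 < ρ) (h1 : ρ < 1) (c : ℕ → Bool) : |val ρ c| ≤ ρ / (1 - ρ) := by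
  have hs : HasSum (fun n : ℕ => ρ ^ (n + 1)) (ρ / (1 - ρ)) := by
    have := (hasSum_geometric_of_lt_one h0.le h1).mul_left ρ
    simpa [pow_succ', div_eq_mul_inv] using this
  rw [← Real.norm_eq_abs, val]
  refine tsum_of_norm_bounded hs fun n => ?_
  rw [norm_mul, Real.norm_eq_abs, abs_sgn, one_mul, Real.norm_eq_abs, abs_of_pos (by positivity)]

/-- A bounded solution of the recursion satisfied by the tail values is the value. -/
lemma val_eq_of_recursion (h0 : 0 < ρ) (h1 : ρ < 1) {c : ℕ → Bool} {u : ℕ → ℝ} {B : ℝ}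
    (hB : ∀ n, |u n| ≤ B) (hu : ∀ n, u n = ρ * (sgn (c n) + u (n + 1))) (n : ℕ) :
    val ρ (shift n c) = u n := by
  have key : ∀ j, |val ρ (shift n c) - u n| ≤ ρ ^ j * (ρ / (1 - ρ) + B) := by
    intro j
    have : val ρ (shift n c) - u n = ρ ^ j * (val ρ (shift (n + j) c) - u (n + j)) := by
      induction j with
      | zero => simp
      | succ j ih =>
        rw [ih, val_shift_step h0 h1, hu (n + j)]
        ring_nf
    rw [this, abs_mul, abs_of_pos (pow_pos h0 j)]
    gcongr
    exact (abs_sub _ _).trans (add_le_add (abs_val_le h0 h1 _) (hB _))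
  have hlim : Tendsto (fun j : ℕ => ρ ^ j * (ρ / (1 - ρ) + B)) atTop (𝓝 0) := by
    simpa using (tendsto_pow_atTop_nhds_zero_of_lt_one h0.le h1).mul_const (ρ / (1 - ρ) + B)
  have := ge_of_tendsto' hlim key
  exact sub_eq_zero.1 (abs_nonpos_iff.1 this)

/-- Difference of two values in terms of the tails behind the first differing entry. -/
lemma val_sub_val (h0 : 0 < ρ) (h1 : ρ < 1) {c d : ℕ → Bool} {n : ℕ}
    (hcd : ∀ i < n, c i = d i) (hc : c n = false) (hd : d n = true) :
    val ρ d - val ρ c = ρ ^ (n + 1) * (2 + val ρ (shift (n + 1) d) - val ρ (shift (n + 1) c)) := by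
  rw [val_split h0 h1 c (n + 1), val_split h0 h1 d (n + 1), Finset.sum_range_succ,
    Finset.sum_range_succ, hc, hd]
  have : ∑ i ∈ Finset.range n, sgn (c i) * ρ ^ (i + 1)
      = ∑ i ∈ Finset.range n, sgn (d i) * ρ ^ (i + 1) :=
    Finset.sum_congr rfl fun i hi => by rw [hcd i (Finset.mem_range.1 hi)]
  rw [this, sgn_true, sgn_false]
  ring

lemma val_third_lt {c d : ℕ → Bool} (h : Lt c d) : val (1 / 3) c < val (1 / 3) d := by
  obtain ⟨n, hn, hc, hd⟩ := h
  have := val_sub_val (ρ := 1 / 3) (by norm_num) (by norm_num) hn hc hd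
  have h1 := abs_le.1 (abs_val_le (ρ := 1 / 3) (by norm_num) (by norm_num) (shift (n + 1) d))
  have h2 := abs_le.1 (abs_val_le (ρ := 1 / 3) (by norm_num) (by norm_num) (shift (n + 1) c))
  have h3 : (0 : ℝ) < (1 / 3) ^ (n + 1) := by positivity
  norm_num at h1 h2
  have h4 := mul_pos h3 (show (0 : ℝ) < 2 + val (1 / 3) (shift (n + 1) d) -
    val (1 / 3) (shift (n + 1) c) by linarith)
  linarith

lemma eq_or_lt_of_val_third_le {c d : ℕ → Bool} (h : val (1 / 3) c ≤ val (1 / 3) d) :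
    c = d ∨ Lt c d := by
  rcases lt_trichotomy c d with h' | h' | h'
  · exact Or.inl h'
  · exact Or.inr h'
  · exact absurd (val_third_lt h') (not_lt.2 h)

lemma lt_of_val_third_lt {c d : ℕ → Bool} (h : val (1 / 3) c < val (1 / 3) d) : Lt c d := by
  rcases eq_or_lt_of_val_third_le h.le with rfl | h'
  · exact absurd h (lt_irrefl _)
  · exact h'

lemma continuous_val (h0 : 0 < ρ) (h1 : ρ < 1) : Continuous (val ρ) := by
  refine continuous_tsum (u := fun n => ρ ^ (n + 1)) (fun n => ?_) ?_ fun n c => ?_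
  · have : Continuous sgn := continuous_of_discreteTopology
    fun_prop
  · exact (summable_nat_add_iff 1).2 (summable_geometric_of_lt_one h0.le h1)
  · rw [norm_mul, Real.norm_eq_abs, abs_sgn, one_mul, Real.norm_eq_abs, abs_of_pos (by positivity)]

lemma continuous_shift (n : ℕ) : Continuous (shift n) := by
  unfold shift; fun_prop

/-- If `c` and its tails are lexicographically at most `κ`, bounds on the values of the tails of
`κ` pass to the tails of `c`. -/
lemma val_le_of_tails_le (h0 : 0 < ρ) (h1 : ρ < 1) {v : ℝ} (hv : v ≤ 1) {κ : ℕ → Bool}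
    (hκ : val ρ κ ≤ v) (hκ' : ∀ n, -v ≤ val ρ (shift n κ)) {c : ℕ → Bool}
    (hc : ∀ n, val (1 / 3) (shift n c) ≤ val (1 / 3) κ) (n : ℕ) : val ρ (shift n c) ≤ v := by
  set m := ρ / (1 - ρ) + |v| with hm
  have hm0 : 0 ≤ m := by have : 0 < 1 - ρ := by linarith
                         positivity
  have key : ∀ j n, val ρ (shift n c) ≤ v + ρ ^ j * m := by
    intro j
    induction j with
    | zero =>
      intro n
      have := (abs_le.1 (abs_val_le h0 h1 (shift n c))).2
      have := neg_abs_le v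
      simp only [pow_zero, one_mul, hm]; linarith
    | succ j ih =>
      intro n
      have hpos : 0 ≤ ρ ^ (j + 1) * m := by positivity
      rcases eq_or_lt_of_val_third_le (hc n) with h | ⟨p, hp, hp1, hp2⟩
      · rw [h]; linarith
      · have h2 := val_sub_val h0 h1 hp hp1 hp2
        rw [shift_shift] at h2
        have h3 := ih (n + (p + 1))
        have h4 := hκ' (p + 1)
        have h5 : ρ ^ (p + 1) ≤ ρ := by
          simpa using pow_le_pow_of_le_one h0.le h1.le (Nat.succ_le_succ (Nat.zero_le p))
        have h6 : 0 < ρ ^ (p + 1) := by positivity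
        have h7 : 0 ≤ ρ ^ j * m := by positivity
        have h8 : ρ ^ (p + 1) * (ρ ^ j * m) ≤ ρ * (ρ ^ j * m) := by gcongr
        have h9 : ρ ^ (p + 1) * (-(ρ ^ j * m)) ≤ ρ ^ (p + 1) *
          (2 + val ρ (shift (p + 1) κ) - val ρ (shift (n + (p + 1)) c)) := by
          gcongr; linarith
        rw [pow_succ']
        nlinarith
  have hlim : Tendsto (fun j : ℕ => v + ρ ^ j * m) atTop (𝓝 v) := by
    simpa using ((tendsto_pow_atTop_nhds_zero_of_lt_one h0.le h1).mul_const m).const_add v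
  exact ge_of_tendsto' hlim fun j => key j n

/-- Every real of modulus at most `R` is the value of a sequence all of whose tails have values of
modulus at most `R`, when `1 ≤ R ≤ ρ / (1 - ρ)`. -/
lemma exists_val_eq (h0 : 0 < ρ) (h1 : ρ < 1) {R y : ℝ} (hR1 : 1 ≤ R) (hR : R * (1 - ρ) ≤ ρ)
    (hy : |y| ≤ R) : ∃ c, val ρ c = y ∧ ∀ n, |val ρ (shift n c)| ≤ R := by
  let T : ℝ → ℝ := fun y => y / ρ - sgn (decide (0 ≤ y))
  have hT : ∀ y, |y| ≤ R → |T y| ≤ R := by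
    intro y hy
    have hRρ : R / ρ - 1 ≤ R := by
      rw [sub_le_iff_le_add, div_le_iff₀ h0]; nlinarith
    have hy' := abs_le.1 hy
    by_cases h : 0 ≤ y
    · have h3 : 0 ≤ y / ρ := by positivity
      have h4 : y / ρ ≤ R / ρ := by gcongr; exact hy'.2
      simp only [T, h, decide_true, sgn_true]
      rw [abs_le]; constructor <;> linarith
    · push Not at h
      have h3 : y / ρ ≤ 0 := div_nonpos_of_nonpos_of_nonneg h.le h0.le
      have h4 : -(R / ρ) ≤ y / ρ := by rw [← neg_div]; gcongr; exact hy'.1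
      simp only [T, not_le.2 h, decide_false, sgn_false]
      rw [abs_le]; constructor <;> linarith
  let u : ℕ → ℝ := fun n => T^[n] y
  have hu : ∀ n, |u n| ≤ R := by
    intro n
    induction n with
    | zero => simpa [u] using hy
    | succ n ih => simp only [u, Function.iterate_succ_apply'] at ih ⊢; exact hT _ ih
  let c : ℕ → Bool := fun n => decide (0 ≤ u n)
  have hrec : ∀ n, u n = ρ * (sgn (c n) + u (n + 1)) := by
    intro n
    have : u (n + 1) = u n / ρ - sgn (c n) := by
      simp only [u, c, Function.iterate_succ_apply', T]
    rw [this]; field_simp; ring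
  have hval := val_eq_of_recursion h0 h1 hu hrec
  refine ⟨c, by simpa [u] using hval 0, fun n => by rw [hval n]; exact hu n⟩

/-- The dimension of the value set in base `r⁻¹` is controlled by the one in base `q⁻¹`, when the
values in base `q⁻¹` are separated. -/
lemma dimH_image_val_le {q r η : ℝ} (hq0 : 0 < q) (hq1 : q < 1) (hr0 : 0 < r) (hr1 : r < 1)
    (hη : η < 1) {Y : Set (ℕ → Bool)} (hY : ∀ c ∈ Y, ∀ n, |val q (shift n c)| ≤ η) :
    dimH (val r '' Y) ≤ dimH (val q '' Y) / ENNReal.ofReal (Real.log r / Real.log q) := by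
  have hlq := Real.log_neg hq0 hq1
  have hlr := Real.log_neg hr0 hr1
  have ht : 0 < Real.log r / Real.log q := div_pos_of_neg_of_neg hlr hlq
  set t := Real.log r / Real.log q with ht_def
  have hqt : q ^ t = r := by
    rw [Real.rpow_def_of_pos hq0, ht_def, mul_div_cancel₀ _ hlq.ne, Real.exp_log hr0]
  set K := r * (2 + 2 * (r / (1 - r))) with hK
  have hr1' : 0 < 1 - r := by linarith
  have hK0 : 0 ≤ K := by positivity
  set b := q * (2 - 2 * η) with hb
  have hb0 : 0 < b := mul_pos hq0 (by linarith)
  have hlt : ∀ c ∈ Y, ∀ d ∈ Y, Lt c d →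
      0 < val q d - val q c ∧ |val r d - val r c| ≤ K / b ^ t * |val q d - val q c| ^ t := by
    rintro c hc d hd ⟨n, hn, h1, h2⟩
    have e1 := val_sub_val hq0 hq1 hn h1 h2
    have e2 := val_sub_val hr0 hr1 hn h1 h2
    have b1 := abs_le.1 (hY c hc (n + 1))
    have b2 := abs_le.1 (hY d hd (n + 1))
    have b3 := abs_le.1 (abs_val_le hr0 hr1 (shift (n + 1) c))
    have b4 := abs_le.1 (abs_val_le hr0 hr1 (shift (n + 1) d))
    have hpos : q ^ n * b ≤ val q d - val q c := by
      rw [e1, hb, pow_succ, mul_assoc]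
      exact mul_le_mul_of_nonneg_left (mul_le_mul_of_nonneg_left (by linarith) hq0.le)
        (by positivity)
    have hpos' : 0 < q ^ n * b := by positivity
    refine ⟨by linarith, ?_⟩
    have hup : |val r d - val r c| ≤ r ^ n * K := by
      rw [e2, hK, abs_mul, abs_of_pos (by positivity : 0 < r ^ (n + 1)), pow_succ, mul_assoc]
      gcongr
      rw [abs_le]; constructor <;> linarith
    refine hup.trans ?_
    calc r ^ n * K = K / b ^ t * (q ^ n * b) ^ t := by
          rw [Real.mul_rpow (by positivity) hb0.le, ← Real.rpow_natCast q n, ← Real.rpow_mul hq0.le,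
            mul_comm (n : ℝ) t, Real.rpow_mul hq0.le, hqt, Real.rpow_natCast]
          field_simp
      _ ≤ _ := by
          gcongr
          exact hpos.trans (le_abs_self _)
  have hinj : InjOn (val q) Y := by
    intro c hc d hd h
    rcases lt_trichotomy c d with h' | h' | h'
    · exact h'
    · have := (hlt c hc d hd h').1; linarith
    · have := (hlt d hd c hc h').1; linarith
  have hbound : ∀ c ∈ Y, ∀ d ∈ Y, |val r c - val r d| ≤ K / b ^ t * |val q c - val q d| ^ t := by
    intro c hc d hd
    rcases lt_trichotomy c d with rfl | h' | h'
    · simp only [sub_self, abs_zero]; positivity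
    · rw [abs_sub_comm, abs_sub_comm (val q c)]; exact (hlt c hc d hd h').2
    · exact (hlt d hd c hc h').2
  set f : ℝ → ℝ := val r ∘ Function.invFunOn (val q) Y with hf
  have hfv : ∀ c ∈ Y, f (val q c) = val r c := fun c hc => by
    simp only [hf, Function.comp_apply, hinj.leftInvOn_invFunOn hc]
  have himg : f '' (val q '' Y) = val r '' Y := by
    rw [image_image]; exact image_congr hfv
  have hhold : HolderOnWith (K / b ^ t).toNNReal t.toNNReal f (val q '' Y) := by
    rintro _ ⟨c, hc, rfl⟩ _ ⟨d, hd, rfl⟩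
    rw [hfv c hc, hfv d hd, edist_dist, edist_dist, Real.dist_eq, Real.dist_eq,
      Real.coe_toNNReal t ht.le, ENNReal.ofReal_rpow_of_nonneg (abs_nonneg _) ht.le]
    rw [← ENNReal.ofReal, ← ENNReal.ofReal_mul (by positivity)]
    exact ENNReal.ofReal_le_ofReal (hbound c hc d hd)
  have := hhold.dimH_image_le (by simpa using ht)
  rw [himg] at this
  exact this

lemma dimH_image_val_le_of_abs_le {q r η : ℝ} (hq0 : 0 < q) (hq1 : q < 1) (hr0 : 0 < r)
    (hr1 : r < 1) (hη : η < 1) {Y : Set (ℕ → Bool)}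
    (hY : ∀ c ∈ Y, ∀ n, |val q (shift n c)| ≤ η) :
    dimH (val r '' Y) ≤ ENNReal.ofReal (-Real.log q / -Real.log r) := by
  have hlq := Real.log_neg hq0 hq1
  have hlr := Real.log_neg hr0 hr1
  refine (dimH_image_val_le hq0 hq1 hr0 hr1 hη hY).trans ?_
  have h1 : dimH (val q '' Y) ≤ 1 := Real.dimH_univ ▸ dimH_mono (subset_univ _)
  calc _ ≤ 1 / ENNReal.ofReal (Real.log r / Real.log q) := by gcongr
    _ = _ := by
      rw [one_div, ← ENNReal.ofReal_inv_of_pos (div_pos_of_neg_of_neg hlr hlq), inv_div,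
        neg_div_neg_eq]

lemma le_dimH_image_val {q r η : ℝ} (hq0 : 0 < q) (hq1 : q < 1) (hr0 : 0 < r)
    (hr1 : r < 1) (hη : η < 1) {Y : Set (ℕ → Bool)}
    (hY : ∀ c ∈ Y, ∀ n, |val r (shift n c)| ≤ η) (hsurj : Icc (-1) 1 ⊆ val q '' Y) :
    ENNReal.ofReal (-Real.log q / -Real.log r) ≤ dimH (val r '' Y) := by
  have hlq := Real.log_neg hq0 hq1
  have hlr := Real.log_neg hr0 hr1
  have h1 : dimH (val q '' Y) = 1 := by
    refine le_antisymm (Real.dimH_univ ▸ dimH_mono (subset_univ _)) ?_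
    calc (1 : ℝ≥0∞) = dimH (Icc (-1 : ℝ) 1) := by
          rw [Real.dimH_of_nonempty_interior (by simp)]; simp
      _ ≤ _ := dimH_mono hsurj
  have h2 := dimH_image_val_le hr0 hr1 hq0 hq1 hη hY
  have hpos : 0 < Real.log q / Real.log r := div_pos_of_neg_of_neg hlq hlr
  rw [h1, ENNReal.le_div_iff_mul_le (Or.inl (by simpa using hpos)) (Or.inl ENNReal.ofReal_ne_top),
    one_mul] at h2
  rwa [neg_div_neg_eq]

/-- The sequences all of whose tails have values of modulus at most `v`. -/
def tailsWithin (ρ v : ℝ) : Set (ℕ → Bool) := {c | ∀ n, |val ρ (shift n c)| ≤ v}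

lemma shift_mem_tailsWithin {v : ℝ} {c : ℕ → Bool} (hc : c ∈ tailsWithin ρ v) (n : ℕ) :
    shift n c ∈ tailsWithin ρ v := fun m => by
  rw [shift_shift]; exact hc _

lemma neg_mem_tailsWithin {v : ℝ} {c : ℕ → Bool} (hc : c ∈ tailsWithin ρ v) :
    neg c ∈ tailsWithin ρ v := fun m => by
  rw [shift_neg, val_neg, abs_neg]; exact hc m

lemma isCompact_tailsWithin (h0 : 0 < ρ) (h1 : ρ < 1) (v : ℝ) :
    IsCompact (tailsWithin ρ v) := by
  refine IsClosed.isCompact ?_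
  rw [tailsWithin, Set.ofPred_forall]
  exact isClosed_iInter fun n =>
    isClosed_le ((continuous_val h0 h1).comp (continuous_shift n)).abs continuous_const

/-- A one-sided bound on a set closed under shifts and negation is two-sided on all tails. -/
lemma tailsWithin_subset {σ v η : ℝ} (h : ∀ c ∈ tailsWithin ρ v, val σ c ≤ η) :
    tailsWithin ρ v ⊆ tailsWithin σ η := fun c hc n => by
  have h1 := h _ (shift_mem_tailsWithin hc n)
  have h2 := h _ (neg_mem_tailsWithin (shift_mem_tailsWithin hc n))
  rw [val_neg] at h2
  exact abs_le.2 ⟨by linarith, h1⟩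

lemma exists_tailsWithin_add {σ v θ : ℝ} (h0 : 0 < ρ) (h1 : ρ < 1) (hσ0 : 0 < σ) (hσ1 : σ < 1)
    {θ' : ℝ} (hθ : θ < θ') (h : ∀ c ∈ tailsWithin ρ v, val σ c ≤ θ) {η₀ : ℝ} (hη₀ : 0 < η₀) :
    ∃ η, 0 < η ∧ η ≤ η₀ ∧ ∀ c ∈ tailsWithin ρ (v + η), val σ c ≤ θ' := by
  by_contra! hcon
  have hpos : ∀ n : ℕ, 0 < η₀ / (n + 1) := fun n => by positivity
  have hanti : ∀ m n : ℕ, m ≤ n → η₀ / (n + 1) ≤ η₀ / (m + 1) := fun m n hmn => by gcongr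
  have hle : ∀ n : ℕ, η₀ / (n + 1) ≤ η₀ := fun n => by simpa using hanti 0 n (Nat.zero_le n)
  let Z : ℕ → Set (ℕ → Bool) := fun n => tailsWithin ρ (v + η₀ / (n + 1)) ∩ {c | θ' ≤ val σ c}
  have hZc : ∀ n, IsClosed (Z n) := fun n =>
    (isCompact_tailsWithin h0 h1 _).isClosed.inter
      (isClosed_le continuous_const (continuous_val hσ0 hσ1))
  obtain ⟨c, hc⟩ := IsCompact.nonempty_iInter_of_sequence_nonempty_isCompact_isClosed Z
    (fun n => by
      rintro c ⟨hc, hc'⟩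
      refine ⟨fun m => (hc m).trans ?_, hc'⟩
      have := hanti n (n + 1) (Nat.le_succ n)
      linarith)
    (fun n => by
      obtain ⟨c, hc, hc'⟩ := hcon _ (hpos n) (hle n)
      exact ⟨c, hc, hc'.le⟩)
    ((isCompact_tailsWithin h0 h1 _).inter_right
      (isClosed_le continuous_const (continuous_val hσ0 hσ1))) hZc
  rw [mem_iInter] at hc
  have hcv : c ∈ tailsWithin ρ v := fun m => by
    have hlim : Tendsto (fun n : ℕ => v + η₀ / (n + 1)) atTop (𝓝 (v + 0)) :=
      (tendsto_const_div_atTop_nhds_zero_nat η₀ |>.comp (tendsto_add_atTop_nat 1) |>.congr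
        fun n => by simp).const_add v
    rw [add_zero] at hlim
    exact ge_of_tendsto' hlim fun n => (hc n).1 m
  have := h c hcv
  have h' : θ' ≤ val σ c := (hc 0).2
  linarith

lemma analyticOnNhd_val (c : ℕ → Bool) : AnalyticOnNhd ℝ (fun ρ => val ρ c) (Ioo 0 1) := by
  have hd : DifferentiableOn ℂ (fun z : ℂ => ∑' n, (sgn (c n) : ℂ) * z ^ (n + 1))
      (Metric.ball 0 1) := by
    intro z hz
    have hz' : ‖z‖ < 1 := by simpa using hz
    obtain ⟨R, hR, hR1⟩ := exists_between hz'
    have hR0 : 0 ≤ R := (norm_nonneg z).trans hR.le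
    have : DifferentiableOn ℂ (fun z : ℂ => ∑' n, (sgn (c n) : ℂ) * z ^ (n + 1))
        (Metric.ball 0 R) := by
      refine Complex.differentiableOn_tsum_of_summable_norm (u := fun n => R ^ (n + 1))
        ((summable_nat_add_iff 1).2 (summable_geometric_of_lt_one hR0 hR1)) (fun n => by fun_prop)
        Metric.isOpen_ball fun n w hw => ?_
      rw [norm_mul, Complex.norm_real, Real.norm_eq_abs, abs_sgn, one_mul, norm_pow]
      have : ‖w‖ < R := by simpa using hw
      gcongr
    exact (this.differentiableAt (Metric.isOpen_ball.mem_nhds (by simpa using hR)))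
      |>.differentiableWithinAt
  have ha := hd.analyticOnNhd Metric.isOpen_ball
  intro x hx
  have hx' : (x : ℂ) ∈ Metric.ball (0 : ℂ) 1 := by
    simpa [abs_of_pos hx.1] using hx.2
  have := (ha x hx').re_ofReal
  refine this.congr (Eventually.of_forall fun y => ?_)
  have : (∑' n, (sgn (c n) : ℂ) * (y : ℂ) ^ (n + 1)) = ((val y c : ℝ) : ℂ) := by
    simp only [val]
    push_cast
    rfl
  simp [this]

end SignSeq

/-- A set covered by countably many Lipschitz images of `Z` has dimension at most that of `Z`. -/
lemma dimH_le_of_subset_iUnion_affine {ι : Type*} [Countable ι] {E Z : Set ℝ} (p q : ι → ℝ)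
    (h : ∀ x ∈ E, ∃ i, ∃ z ∈ Z, x = p i + q i * z) : dimH E ≤ dimH Z := by
  have hsub : E ⊆ ⋃ i, (fun z => p i + q i * z) '' Z := by
    intro x hx
    obtain ⟨i, z, hz, rfl⟩ := h x hx
    exact mem_iUnion.2 ⟨i, z, hz, rfl⟩
  refine (dimH_mono hsub).trans ?_
  rw [dimH_iUnion]
  refine iSup_le fun i => ?_
  have hl : LipschitzWith (‖q i‖₊) fun z => p i + q i * z := by
    refine LipschitzWith.of_dist_le_mul fun x y => ?_
    rw [Real.dist_eq, Real.dist_eq, add_sub_add_left_eq_sub, ← mul_sub, abs_mul]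
    rfl
  exact hl.dimH_image_le Z

namespace SignSeq

lemma dimH_image_val_le_of_shift_mem {r : ℝ} (h0 : 0 < r) (h1 : r < 1) {E Z : Set (ℕ → Bool)}
    (h : ∀ c ∈ E, ∃ N, shift N c ∈ Z) : dimH (val r '' E) ≤ dimH (val r '' Z) := by
  refine dimH_le_of_subset_iUnion_affine (ι := Σ N, (Fin N → Bool))
    (fun w => ∑ i : Fin w.1, sgn (w.2 i) * r ^ ((i : ℕ) + 1)) (fun w => r ^ w.1) ?_
  rintro _ ⟨c, hc, rfl⟩
  obtain ⟨N, hN⟩ := h c hc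
  refine ⟨⟨N, fun i => c i⟩, _, mem_image_of_mem _ hN, ?_⟩
  rw [val_split h0 h1 c N, Finset.sum_range]

/-- The sequences satisfying asymptotically the lexicographic-type condition that every tail
following a negative (positive) sign has value at most `v` (at least `-v`). -/
def eventuallyWithin (a v : ℝ) : Set (ℕ → Bool) :=
  {c | ∀ η > 0, ∃ N, ∀ n ≥ N, (c n = false → val a (shift (n + 1) c) ≤ v + η) ∧
    (c n = true → -(val a (shift (n + 1) c)) ≤ v + η)}

lemma exists_shift_mem_of_eventuallyWithin {a v η : ℝ} (h0 : 0 < a) (h1 : a < 1) (hη : 0 < η)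
    (hv : (v + η) * (1 - a) ≤ a) {c : ℕ → Bool} (hc : c ∈ eventuallyWithin a v) :
    ∃ N, shift N c ∈ tailsWithin a (v + η) ∪ {fun _ => true, fun _ => false} := by
  obtain ⟨N, hN⟩ := hc η hη
  by_cases hf : ∃ n ≥ N, c n = false
  swap
  · push Not at hf
    refine ⟨N, Or.inr (Or.inl ?_)⟩
    funext i
    simpa [shift] using hf (N + i) (by omega)
  by_cases ht : ∃ n ≥ N, c n = true
  swap
  · push Not at ht
    refine ⟨N, Or.inr (Or.inr ?_)⟩
    show shift N c = fun _ => false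
    funext i
    simpa [shift] using ht (N + i) (by omega)
  obtain ⟨n, hn, hcn⟩ := hf
  obtain ⟨m, hm, hcm⟩ := ht
  have hup : ∀ j, val a (shift (n + 1 + j) c) ≤ v + η := by
    intro j
    induction j with
    | zero => exact (hN n hn).1 hcn
    | succ j ih =>
      cases hb : c (n + 1 + j) with
      | false => exact (hN (n + 1 + j) (by omega)).1 hb
      | true =>
        rw [val_shift_step h0 h1, hb, sgn_true, add_assoc (n + 1) j 1] at ih
        by_contra! hcon
        nlinarith
  have hdn : ∀ j, -(val a (shift (m + 1 + j) c)) ≤ v + η := by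
    intro j
    induction j with
    | zero => exact (hN m hm).2 hcm
    | succ j ih =>
      cases hb : c (m + 1 + j) with
      | true => exact (hN (m + 1 + j) (by omega)).2 hb
      | false =>
        rw [val_shift_step h0 h1, hb, sgn_false, add_assoc (m + 1) j 1] at ih
        by_contra! hcon
        nlinarith
  refine ⟨n + 1 + (m + 1), Or.inl fun j => ?_⟩
  rw [shift_shift, abs_le]
  have e1 := hup (m + 1 + j)
  have e2 := hdn (n + 1 + j)
  rw [← add_assoc] at e1
  rw [show m + 1 + (n + 1 + j) = n + 1 + (m + 1) + j by ring] at e2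
  constructor <;> linarith

lemma dimH_image_val_eventuallyWithin_le {a v ρ θ r : ℝ} (h0 : 0 < a) (h1 : a < 1)
    (hv : v < 1) (ha : 1 - a ≤ a) (hρ0 : 0 < ρ) (hρ1 : ρ < 1) (hθ : θ < 1)
    (h : ∀ c ∈ tailsWithin a v, val ρ c ≤ θ) (hr0 : 0 < r) (hr1 : r < 1) :
    dimH (val r '' eventuallyWithin a v) ≤ ENNReal.ofReal (-Real.log ρ / -Real.log r) := by
  obtain ⟨θ', h2, h3⟩ := exists_between hθ
  obtain ⟨η, hη, hη1, hX⟩ := exists_tailsWithin_add h0 h1 hρ0 hρ1 h2 h (sub_pos.2 hv)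
  refine (dimH_image_val_le_of_shift_mem hr0 hr1 fun c hc =>
    exists_shift_mem_of_eventuallyWithin (η := η) h0 h1 hη (by nlinarith) hc).trans ?_
  rw [image_union, dimH_union]
  refine max_le (dimH_image_val_le_of_abs_le hρ0 hρ1 hr0 hr1 h3 fun c hc =>
    tailsWithin_subset hX hc) ?_
  rw [dimH_finite ((toFinite _).image _)]
  exact zero_le

lemma val_le_val_of_abs_le_one {ρ : ℝ} (h0 : 0 < ρ) (h1 : ρ < 1) {c d : ℕ → Bool}
    (hc : ∀ n, |val ρ (shift n c)| ≤ 1) (hd : ∀ n, |val ρ (shift n d)| ≤ 1)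
    (h : val (1 / 3) c ≤ val (1 / 3) d) : val ρ c ≤ val ρ d := by
  rcases eq_or_lt_of_val_third_le h with rfl | ⟨n, hn, e1, e2⟩
  · rfl
  · have := val_sub_val h0 h1 hn e1 e2
    have b1 := abs_le.1 (hc (n + 1))
    have b2 := abs_le.1 (hd (n + 1))
    have : 0 ≤ val ρ d - val ρ c := this ▸ mul_nonneg (by positivity) (by linarith)
    linarith

lemma exists_isMaxOn_val_third {Y : Set (ℕ → Bool)} (hY : IsCompact Y) (hne : Y.Nonempty) :
    ∃ κ ∈ Y, ∀ c ∈ Y, val (1 / 3) c ≤ val (1 / 3) κ :=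
  hY.exists_isMaxOn hne (continuous_val (by norm_num) (by norm_num)).continuousOn

/-- If `ρ` ranges over an interval on which no uniform bound below `1` holds for the values of the
sequences of `tailsWithin a v`, then one of these values exceeds `1`. -/
lemma exists_one_lt_val {a v s t : ℝ} (h0 : 0 < a) (h1 : a < 1) (hv : v < 1) (hs : 0 ≤ s)
    (ht : t ≤ 1) (hst : s < t)
    (h : ∀ ρ ∈ Ioo s t, ∀ θ < 1, ∃ c ∈ tailsWithin a v, θ < val ρ c) :
    ∃ ρ ∈ Ioo s t, ∃ c ∈ tailsWithin a v, 1 < val ρ c := by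
  by_contra! hcon
  obtain ⟨ρ₁, hρ₁⟩ : (Ioo s t).Nonempty := nonempty_Ioo.2 hst
  obtain ⟨c₁, hc₁, -⟩ := h ρ₁ hρ₁ 0 one_pos
  obtain ⟨α, hα, hmax⟩ := exists_isMaxOn_val_third (isCompact_tailsWithin h0 h1 v) ⟨c₁, hc₁⟩
  have hone : ∀ ρ ∈ Ioo s t, val ρ α = 1 := by
    intro ρ hρ
    have hsub := tailsWithin_subset (hcon ρ hρ)
    by_contra hne
    obtain ⟨c, hc, hlt⟩ := h ρ hρ (val ρ α) (lt_of_le_of_ne (hcon ρ hρ α hα) hne)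
    exact absurd (val_le_val_of_abs_le_one (hs.trans_lt hρ.1) (hρ.2.trans_le ht) (hsub hc)
      (hsub hα) (hmax c hc)) (not_le.2 hlt)
  have hρ₁' : ρ₁ ∈ Ioo (0 : ℝ) 1 := ⟨hs.trans_lt hρ₁.1, hρ₁.2.trans_le ht⟩
  have heq := (analyticOnNhd_val α).eqOn_of_preconnected_of_eventuallyEq
    (g := fun _ => (1 : ℝ)) analyticOnNhd_const isPreconnected_Ioo hρ₁'
    (eventually_of_mem (Ioo_mem_nhds hρ₁.1 hρ₁.2) hone)
  have e1 : val a α = 1 := heq ⟨h0, h1⟩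
  have e2 := (abs_le.1 (hα 0)).2
  rw [shift_zero, e1] at e2
  linarith

lemma exists_separated_subset {a v ρ : ℝ} (h0 : 0 < a) (h1 : a < 1) (hv : v < 1)
    (hρ : 1 / 2 ≤ ρ) (hρ1 : ρ < 1) {c₀ : ℕ → Bool} (hc₀ : c₀ ∈ tailsWithin a v)
    (hlt : 1 < val ρ c₀) :
    ∃ ε > 0, tailsWithin ρ 1 ⊆ tailsWithin a (v - ε) := by
  have hρ0 : 0 < ρ := by linarith
  have hYc := isCompact_tailsWithin hρ0 hρ1 1
  have hYne : (tailsWithin ρ 1).Nonempty := by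
    obtain ⟨c, -, hc⟩ := exists_val_eq (y := 0) hρ0 hρ1 le_rfl (by linarith) (by norm_num)
    exact ⟨c, hc⟩
  obtain ⟨κ, hκ, hκmax⟩ := exists_isMaxOn_val_third hYc hYne
  obtain ⟨α, hα, hαmax⟩ := exists_isMaxOn_val_third (isCompact_tailsWithin h0 h1 v) ⟨c₀, hc₀⟩
  have hκα : val (1 / 3) κ < val (1 / 3) α := by
    by_contra! hle
    have := val_le_of_tails_le hρ0 hρ1 le_rfl (by simpa using (abs_le.1 (hκ 0)).2)
      (fun n => (abs_le.1 (hκ n)).1)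
      (fun n => (hαmax _ (shift_mem_tailsWithin hc₀ n)).trans hle) 0
    rw [shift_zero] at this
    linarith
  have hle : ∀ c ∈ tailsWithin ρ 1, val a c ≤ v := fun c hc => by
    have := val_le_of_tails_le h0 h1 hv.le (by simpa using (abs_le.1 (hα 0)).2)
      (fun n => (abs_le.1 (hα n)).1)
      (fun n => (hκmax _ (shift_mem_tailsWithin hc n)).trans hκα.le) 0
    rwa [shift_zero] at this
  have hstrict : ∀ c ∈ tailsWithin ρ 1, val a c < v := fun c hc => by
    obtain ⟨n, hn, e1, e2⟩ := lt_of_val_third_lt ((hκmax c hc).trans_lt hκα)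
    have := val_sub_val h0 h1 hn e1 e2
    have b1 := abs_le.1 (tailsWithin_subset hle hc (n + 1))
    have b2 := abs_le.1 (hα (n + 1))
    have b3 := abs_le.1 (hα 0)
    rw [shift_zero] at b3
    have : 0 < val a α - val a c := this ▸ mul_pos (by positivity) (by linarith)
    linarith
  obtain ⟨μ, hμ, hμmax⟩ := hYc.exists_isMaxOn hYne (continuous_val h0 h1).continuousOn
  refine ⟨v - val a μ, sub_pos.2 (hstrict μ hμ), tailsWithin_subset fun c hc => ?_⟩
  rw [sub_sub_cancel]
  exact hμmax hc

/-- The symbolic dimension theorem: the sets of sequences asymptotically (respectively strictly)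
within `v` at the base `a⁻¹` have the same entropy `δ`. -/
theorem exists_entropy {a v : ℝ} (ha : 1 / 2 < a) (h1 : a < 1) (hv : v < 1) :
    ∃ δ : ℝ, (∀ r : ℝ, 0 < r → r < 1 →
        dimH (val r '' eventuallyWithin a v) ≤ ENNReal.ofReal (δ / -Real.log r)) ∧
      ∀ δ' < δ, ∃ ε > 0, ∃ Y ⊆ tailsWithin a (v - ε), ∀ r ∈ ({1 / 3, a} : Set ℝ),
        ENNReal.ofReal (δ' / -Real.log r) ≤ dimH (val r '' Y) := by
  have h0 : 0 < a := by linarith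
  set S : Set ℝ := {ρ | a ≤ ρ ∧ ρ < 1 ∧ ∃ θ < 1, ∀ c ∈ tailsWithin a v, val ρ c ≤ θ} with hS
  have haS : a ∈ S := ⟨le_rfl, h1, v, hv, fun c hc => by simpa using (abs_le.1 (hc 0)).2⟩
  have hbdd : BddAbove S := ⟨1, fun ρ hρ => hρ.2.1.le⟩
  have hle : a ≤ sSup S := le_csSup hbdd haS
  have hle1 : sSup S ≤ 1 := csSup_le ⟨a, haS⟩ fun ρ hρ => hρ.2.1.le
  refine ⟨-Real.log (sSup S), fun r hr0 hr1 => ?_, fun δ' hδ' => ?_⟩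
  · obtain ⟨u, -, hu, huS⟩ := exists_seq_tendsto_sSup ⟨a, haS⟩ hbdd
    have hlim : Tendsto (fun n => ENNReal.ofReal (-Real.log (u n) / -Real.log r)) atTop
        (𝓝 (ENNReal.ofReal (-Real.log (sSup S) / -Real.log r))) :=
      ENNReal.tendsto_ofReal
        ((((Real.continuousAt_log (by linarith)).tendsto.comp hu).neg).div_const _)
    refine ge_of_tendsto' hlim fun n => ?_
    obtain ⟨h2, h3, θ, hθ, h4⟩ := huS n
    exact dimH_image_val_eventuallyWithin_le h0 h1 hv (by linarith) (by linarith) h3 hθ h4 hr0 hr1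
  · rcases le_or_gt δ' 0 with hneg | hpos
    · refine ⟨1, one_pos, ∅, empty_subset _, fun r hr => ?_⟩
      have hr' : Real.log r < 0 := by
        rcases hr with rfl | rfl
        · exact Real.log_neg (by norm_num) (by norm_num)
        · exact Real.log_neg h0 h1
      rw [ENNReal.ofReal_of_nonpos (div_nonpos_of_nonpos_of_nonneg hneg (by linarith))]
      exact zero_le
    · have hs : sSup S < Real.exp (-δ') := by
        rw [← Real.log_lt_iff_lt_exp (by linarith)]; linarith
      have hexp : Real.exp (-δ') ≤ 1 := Real.exp_le_one_iff.2 (by linarith)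
      obtain ⟨ρ, hρ, c₀, hc₀, hlt⟩ := exists_one_lt_val (a := a) (v := v) h0 h1 hv
        (h0.le.trans hle) hexp hs fun ρ hρ θ hθ => by
          by_contra! hcon
          exact absurd (le_csSup hbdd (⟨hle.trans hρ.1.le, hρ.2.trans_le hexp, θ, hθ, hcon⟩ : ρ ∈ S))
            (not_le.2 hρ.1)
      have hρ1 : ρ < 1 := hρ.2.trans_le hexp
      have hρa : a < ρ := hle.trans_lt hρ.1
      obtain ⟨ε, hε, hY⟩ := exists_separated_subset h0 h1 hv (by linarith) hρ1 hc₀ hlt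
      have hsurj : Icc (-1) 1 ⊆ val ρ '' tailsWithin ρ 1 := fun y hy => by
        obtain ⟨c, hc, hc'⟩ := exists_val_eq (y := y) (by linarith) hρ1 le_rfl (by linarith)
          (abs_le.2 hy)
        exact ⟨c, hc', hc⟩
      have hδρ : δ' ≤ -Real.log ρ := by
        have := (Real.log_lt_iff_lt_exp (by linarith : 0 < ρ)).2 hρ.2
        linarith
      refine ⟨ε, hε, _, hY, fun r hr => ?_⟩
      obtain ⟨hr0, hr1, η, hη, hsep⟩ : 0 < r ∧ r < 1 ∧ ∃ η < 1, ∀ c ∈ tailsWithin ρ 1, ∀ n,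
          |val r (shift n c)| ≤ η := by
        rcases hr with rfl | rfl
        · refine ⟨by norm_num, by norm_num, 1 / 2, by norm_num, fun c _ n => ?_⟩
          have := abs_val_le (ρ := 1 / 3) (by norm_num) (by norm_num) (shift n c)
          norm_num at this ⊢
          exact this
        · exact ⟨h0, h1, v - ε, by linarith, fun c hc n => hY hc n⟩
      have hlog := Real.log_neg hr0 hr1
      refine le_trans (ENNReal.ofReal_le_ofReal ?_)
        (le_dimH_image_val (by linarith : 0 < ρ) hρ1 hr0 hr1 hη hsep hsurj)
      exact div_le_div_of_nonneg_right hδρ (by linarith)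

end SignSeq

namespace OkamotoFun

/-- The scaling factor of `F_b` on the ternary interval with digit `i`. -/
noncomputable def rDig (b : ℝ) (i : ℕ) : ℝ := if i = 1 then 1 - 2 * b else b

/-- The `n`-th term of the series defining Okamoto's function. -/
noncomputable def seriesTerm (b x : ℝ) (n : ℕ) : ℝ :=
  b ^ (n - lCount x n) * (1 - 2 * b) ^ lCount x n * qDig b (tDigit x n)

lemma lCount_le (x : ℝ) (n : ℕ) : lCount x n ≤ n := by
  simpa [lCount] using Finset.card_filter_le (Finset.range n) fun i => tDigit x i = 1

lemma ne_one_of_lt {t : ℝ} {i : ℕ} (hi : i < 3) (ht1 : t < 1) : ((i : ℝ) + t) / 3 ≠ 1 := by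
  have : (i : ℝ) ≤ 2 := by exact_mod_cast Nat.lt_succ_iff.1 hi
  intro h
  linarith

lemma tDigit_add_div_zero {t : ℝ} {i : ℕ} (hi : i < 3) (ht0 : 0 ≤ t) (ht1 : t < 1) :
    tDigit ((i + t) / 3) 0 = i := by
  have hi' : (i : ℝ) ≤ 2 := by exact_mod_cast Nat.lt_succ_iff.1 hi
  rw [tDigit, if_neg (ne_one_of_lt hi ht1)]
  have e1 : ⌊(3 : ℝ) ^ (0 + 1) * ((i + t) / 3)⌋ = i := by
    rw [Int.floor_eq_iff]
    push_cast
    constructor <;> linarith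
  have e2 : ⌊(3 : ℝ) ^ 0 * ((i + t) / 3)⌋ = 0 := by
    rw [Int.floor_eq_zero_iff]
    constructor <;> [positivity; linarith]
  rw [e1, e2]
  simp

lemma tDigit_add_div_succ {t : ℝ} {i : ℕ} (hi : i < 3) (ht1 : t < 1) (n : ℕ) :
    tDigit ((i + t) / 3) (n + 1) = tDigit t n := by
  rw [tDigit, tDigit, if_neg (ne_one_of_lt hi ht1), if_neg ht1.ne]
  have key : ∀ m : ℕ, ⌊(3 : ℝ) ^ (m + 1) * ((i + t) / 3)⌋ = 3 ^ m * i + ⌊(3 : ℝ) ^ m * t⌋ := by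
    intro m
    rw [show (3 : ℝ) ^ (m + 1) * ((i + t) / 3) = ((3 ^ m * i : ℤ) : ℝ) + 3 ^ m * t by
      push_cast; ring, Int.floor_intCast_add]
  rw [key, key]
  congr 1
  ring

lemma lCount_add_div_succ {t : ℝ} {i : ℕ} (hi : i < 3) (ht0 : 0 ≤ t) (ht1 : t < 1) (n : ℕ) :
    lCount ((i + t) / 3) (n + 1) = lCount t n + if i = 1 then 1 else 0 := by
  simp only [lCount, Finset.card_filter]
  rw [Finset.sum_range_succ', tDigit_add_div_zero hi ht0 ht1]
  simp only [tDigit_add_div_succ hi ht1]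

lemma seriesTerm_add_div_zero {t : ℝ} {i : ℕ} (hi : i < 3) (ht0 : 0 ≤ t) (ht1 : t < 1) (b : ℝ) :
    seriesTerm b ((i + t) / 3) 0 = qDig b i := by
  simp [seriesTerm, lCount, tDigit_add_div_zero hi ht0 ht1]

lemma seriesTerm_add_div_succ {t : ℝ} {i : ℕ} (hi : i < 3) (ht0 : 0 ≤ t) (ht1 : t < 1) (b : ℝ)
    (n : ℕ) :
    seriesTerm b ((i + t) / 3) (n + 1) = rDig b i * seriesTerm b t n := by
  rw [seriesTerm, seriesTerm, lCount_add_div_succ hi ht0 ht1, tDigit_add_div_succ hi ht1, rDig]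
  have := lCount_le t n
  split_ifs
  · rw [Nat.add_sub_add_right]
    ring
  · rw [add_zero, show n + 1 - lCount t n = n - lCount t n + 1 by omega]
    ring

lemma norm_term_le {𝕜 : Type*} [NormedField 𝕜] {z w q : 𝕜} {ρ : ℝ} {l n : ℕ} (hl : l ≤ n)
    (hz : ‖z‖ ≤ ρ) (hw : ‖w‖ ≤ ρ) (hq : ‖q‖ ≤ 2) : ‖z ^ (n - l) * w ^ l * q‖ ≤ ρ ^ n * 2 := by
  have hρ : 0 ≤ ρ := (norm_nonneg z).trans hz
  rw [norm_mul, norm_mul, norm_pow, norm_pow]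
  calc ‖z‖ ^ (n - l) * ‖w‖ ^ l * ‖q‖ ≤ ρ ^ (n - l) * ρ ^ l * 2 := by gcongr
    _ = ρ ^ n * 2 := by rw [← pow_add, Nat.sub_add_cancel hl]

lemma abs_qDig_le {b : ℝ} (hb : b ∈ Ioo (0 : ℝ) 1) (i : ℕ) : |qDig b i| ≤ 2 := by
  unfold qDig
  split_ifs
  · simp
  · rw [abs_of_pos hb.1]; linarith [hb.2]
  · rw [abs_of_pos (by linarith [hb.2])]; linarith [hb.1]

lemma exists_abs_seriesTerm_le {b : ℝ} (hb : b ∈ Ioo (0 : ℝ) 1) :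
    ∃ ρ, 0 ≤ ρ ∧ ρ < 1 ∧ ∀ x n, |seriesTerm b x n| ≤ ρ ^ n * 2 := by
  refine ⟨max |b| |1 - 2 * b|, by positivity, ?_, fun x n => ?_⟩
  · rw [max_lt_iff, abs_lt, abs_lt]
    refine ⟨⟨?_, ?_⟩, ?_, ?_⟩ <;> linarith [hb.1, hb.2]
  · exact norm_term_le (𝕜 := ℝ) (lCount_le x n) (le_max_left |b| |1 - 2 * b|) (le_max_right _ _)
      (abs_qDig_le hb _)

lemma summable_seriesTerm {b : ℝ} (hb : b ∈ Ioo (0 : ℝ) 1) (x : ℝ) : Summable (seriesTerm b x) := by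
  obtain ⟨ρ, h0, h1, h⟩ := exists_abs_seriesTerm_le hb
  exact .of_norm_bounded ((summable_geometric_of_lt_one h0 h1).mul_right 2) (h x)

lemma okamoto_zero (b : ℝ) : Okamoto b 0 = 0 := by
  simp [Okamoto, tDigit, qDig]

lemma okamoto_one {b : ℝ} (hb : b ∈ Ioo (0 : ℝ) 1) : Okamoto b 1 = 1 := by
  have h : ∀ n, tDigit 1 n = 2 := fun n => by simp [tDigit]
  have : ∀ n, b ^ (n - lCount 1 n) * (1 - 2 * b) ^ lCount 1 n * qDig b (tDigit 1 n)
      = b ^ n * (1 - b) := fun n => by simp [h, lCount, qDig]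
  rw [Okamoto, tsum_congr this, tsum_mul_right, tsum_geometric_of_lt_one hb.1.le hb.2,
    inv_mul_cancel₀ (by linarith [hb.2])]

lemma okamoto_add_div_of_lt {b t : ℝ} {i : ℕ} (hb : b ∈ Ioo (0 : ℝ) 1) (hi : i < 3) (ht0 : 0 ≤ t)
    (ht1 : t < 1) : Okamoto b ((i + t) / 3) = qDig b i + rDig b i * Okamoto b t := by
  change ∑' n, seriesTerm b _ n = _ + _ * ∑' n, seriesTerm b t n
  rw [(summable_seriesTerm hb _).tsum_eq_zero_add, seriesTerm_add_div_zero hi ht0 ht1,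
    ← tsum_mul_left]
  simp only [seriesTerm_add_div_succ hi ht0 ht1]

/-- The self-affinity of Okamoto's function. -/
lemma okamoto_add_div {b t : ℝ} {i : ℕ} (hb : b ∈ Ioo (0 : ℝ) 1) (hi : i < 3)
    (ht : t ∈ Icc (0 : ℝ) 1) : Okamoto b ((i + t) / 3) = qDig b i + rDig b i * Okamoto b t := by
  rcases ht.2.lt_or_eq with ht1 | rfl
  · exact okamoto_add_div_of_lt hb hi ht.1 ht1
  · rw [okamoto_one hb]
    have key : ∀ j : ℕ, j < 3 → Okamoto b (j / 3) = qDig b j := fun j hj => by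
      simpa [okamoto_zero] using okamoto_add_div_of_lt (t := 0) hb hj le_rfl one_pos
    interval_cases i
    · have := key 1 (by norm_num)
      norm_num [qDig, rDig] at this ⊢
      exact this
    · have := key 2 (by norm_num)
      norm_num [qDig, rDig] at this ⊢
      rw [this]; ring
    · norm_num [qDig, rDig]
      exact okamoto_one hb

lemma exists_eq_add_div {x : ℝ} (hx : x ∈ Icc (0 : ℝ) 1) :
    ∃ i < 3, ∃ t ∈ Icc (0 : ℝ) 1, x = ((i : ℕ) + t) / 3 := by
  rcases le_or_gt x (1 / 3) with h | h
  · exact ⟨0, by norm_num, 3 * x, ⟨by linarith [hx.1], by linarith⟩, by push_cast; ring⟩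
  rcases le_or_gt x (2 / 3) with h' | h'
  · exact ⟨1, by norm_num, 3 * x - 1, ⟨by linarith, by linarith⟩, by push_cast; ring⟩
  · exact ⟨2, by norm_num, 3 * x - 2, ⟨by linarith, by linarith [hx.2]⟩, by push_cast; ring⟩

lemma abs_okamoto_sub_half_le {a : ℝ} (ha : 1 / 2 < a) (ha1 : a < 1) {x : ℝ}
    (hx : x ∈ Icc (0 : ℝ) 1) : |Okamoto a x - 1 / 2| ≤ 1 / 2 := by
  have hb : a ∈ Ioo (0 : ℝ) 1 := ⟨by linarith, ha1⟩
  obtain ⟨ρ, h0, h1, h⟩ := exists_abs_seriesTerm_le hb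
  have hB : ∀ x, |Okamoto a x| ≤ (1 - ρ)⁻¹ * 2 := fun x => by
    rw [← Real.norm_eq_abs]
    exact tsum_of_norm_bounded ((hasSum_geometric_of_lt_one h0 h1).mul_right 2) (h x)
  have key : ∀ n : ℕ, ∀ x ∈ Icc (0 : ℝ) 1,
      |Okamoto a x - 1 / 2| ≤ 1 / 2 + a ^ n * ((1 - ρ)⁻¹ * 2) := by
    intro n
    induction n with
    | zero =>
      intro x _
      have := abs_le.1 (hB x)
      rw [abs_le, pow_zero, one_mul]
      constructor <;> linarith
    | succ n ih =>
      intro x hx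
      obtain ⟨i, hi, t, ht, rfl⟩ := exists_eq_add_div hx
      rw [okamoto_add_div hb hi ht]
      have := abs_le.1 (ih t ht)
      set e := a ^ n * ((1 - ρ)⁻¹ * 2) with he
      have he0 : 0 ≤ e := by
        have : 0 < 1 - ρ := by linarith
        have := hb.1
        positivity
      rw [pow_succ', mul_assoc, ← he, abs_le]
      interval_cases i <;> norm_num [qDig, rDig] <;> constructor <;> nlinarith
  have hlim : Tendsto (fun n : ℕ => 1 / 2 + a ^ n * ((1 - ρ)⁻¹ * 2)) atTop (𝓝 (1 / 2 + 0 * _)) :=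
    ((tendsto_pow_atTop_nhds_zero_of_lt_one hb.1.le hb.2).mul_const _).const_add _
  rw [zero_mul, add_zero] at hlim
  exact ge_of_tendsto' hlim fun n => key n x hx

lemma okamoto_mem_Icc {a : ℝ} (ha : 1 / 2 < a) (ha1 : a < 1) {x : ℝ}
    (hx : x ∈ Icc (0 : ℝ) 1) : Okamoto a x ∈ Icc (0 : ℝ) 1 := by
  have := abs_le.1 (abs_okamoto_sub_half_le ha ha1 hx)
  constructor <;> linarith

/-- Iterated derivatives commute with restriction to the real line. -/
lemma iteratedDeriv_eq_re {U : Set ℂ} (hU : IsOpen U) {f : ℂ → ℂ} (hf : DifferentiableOn ℂ f U)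
    {g : ℝ → ℝ} (hg : ∀ b : ℝ, g b = (f b).re) (j : ℕ) {b : ℝ} (hb : (b : ℂ) ∈ U) :
    iteratedDeriv j g b = (iteratedDeriv j f b).re := by
  induction j generalizing b with
  | zero => simp [hg]
  | succ j ih =>
    have hd : DifferentiableAt ℂ (iteratedDeriv j f) b := by
      rw [iteratedDeriv_eq_iterate]
      exact ((hf.analyticAt (hU.mem_nhds hb)).iterated_deriv j).differentiableAt
    have he : iteratedDeriv j g =ᶠ[𝓝 b] fun x : ℝ => (iteratedDeriv j f x).re := by
      filter_upwards [Complex.continuous_ofReal.continuousAt.eventually (hU.mem_nhds hb)] with x hx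
      exact ih hx
    rw [iteratedDeriv_succ, iteratedDeriv_succ, he.deriv_eq]
    exact hd.hasDerivAt.real_of_complex.deriv

/-- The holomorphic extension of `b ↦ F_b(x)`. -/
noncomputable def okamotoC (x : ℝ) (z : ℂ) : ℂ :=
  ∑' n, z ^ (n - lCount x n) * (1 - 2 * z) ^ lCount x n *
    (if tDigit x n = 0 then 0 else if tDigit x n = 1 then z else 1 - z)

lemma okamoto_eq_re (x b : ℝ) : Okamoto b x = (okamotoC x b).re := by
  rw [← Complex.ofReal_re (Okamoto b x), Okamoto, okamotoC, Complex.ofReal_tsum]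
  congr 1
  refine tsum_congr fun n => ?_
  unfold qDig
  split_ifs <;> push_cast <;> rfl

/-- A domain of convergence for `okamotoC`. -/
def domainC (ρ : ℝ) : Set ℂ := {z | ‖z‖ < ρ} ∩ {z | ‖1 - 2 * z‖ < ρ}

lemma isOpen_domainC (ρ : ℝ) : IsOpen (domainC ρ) :=
  (isOpen_lt (by fun_prop) continuous_const).inter (isOpen_lt (by fun_prop) continuous_const)

lemma norm_okamotoC_term_le {ρ : ℝ} (hρ : ρ < 1) (x : ℝ) {z : ℂ} (hz : z ∈ domainC ρ) (n : ℕ) :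
    ‖z ^ (n - lCount x n) * (1 - 2 * z) ^ lCount x n *
      (if tDigit x n = 0 then 0 else if tDigit x n = 1 then z else 1 - z)‖ ≤ ρ ^ n * 2 := by
  refine norm_term_le (lCount_le x n) hz.1.le hz.2.le ?_
  have : ‖z‖ < ρ := hz.1
  split_ifs
  · simp
  · linarith
  · have := norm_sub_le (1 : ℂ) z
    rw [norm_one] at this
    linarith

lemma differentiableOn_okamotoC {ρ : ℝ} (h0 : 0 ≤ ρ) (hρ : ρ < 1) (x : ℝ) :
    DifferentiableOn ℂ (okamotoC x) (domainC ρ) := by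
  refine Complex.differentiableOn_tsum_of_summable_norm
    ((summable_geometric_of_lt_one h0 hρ).mul_right 2) (fun n => ?_) (isOpen_domainC ρ)
    fun n z hz => norm_okamotoC_term_le hρ x hz n
  split_ifs <;> fun_prop

lemma norm_okamotoC_le {ρ : ℝ} (h0 : 0 ≤ ρ) (hρ : ρ < 1) (x : ℝ) {z : ℂ} (hz : z ∈ domainC ρ) :
    ‖okamotoC x z‖ ≤ (1 - ρ)⁻¹ * 2 :=
  tsum_of_norm_bounded ((hasSum_geometric_of_lt_one h0 hρ).mul_right 2)
    fun n => norm_okamotoC_term_le hρ x hz n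

lemma mem_domainC {a : ℝ} (ha : 1 / 2 < a) (ha1 : a < 1) : (a : ℂ) ∈ domainC ((1 + a) / 2) := by
  refine ⟨?_, ?_⟩ <;> rw [mem_ofPred_eq]
  · rw [Complex.norm_real, Real.norm_eq_abs, abs_of_pos (by linarith)]
    linarith
  · rw [show (1 : ℂ) - 2 * a = ((1 - 2 * a : ℝ) : ℂ) by push_cast; ring, Complex.norm_real,
      Real.norm_eq_abs, abs_of_neg (by linarith)]
    linarith

lemma contDiffAt_okamoto {a : ℝ} (ha : 1 / 2 < a) (ha1 : a < 1) (x : ℝ) (n : ℕ) :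
    ContDiffAt ℝ n (fun b => Okamoto b x) a := by
  simp only [okamoto_eq_re]
  refine ContDiffAt.real_of_complex ?_
  exact ((differentiableOn_okamotoC (by linarith) (by linarith) x).analyticAt
    ((isOpen_domainC _).mem_nhds (mem_domainC ha ha1))).contDiffAt

/-- The derivatives `M_{j,a}` are bounded. -/
lemma exists_abs_Mfun_le {a : ℝ} (ha : 1 / 2 < a) (ha1 : a < 1) (j : ℕ) :
    ∃ B, ∀ x, |Mfun j a x| ≤ B := by
  set ρ := (1 + a) / 2 with hρ
  have h0 : 0 ≤ ρ := by linarith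
  have h1 : ρ < 1 := by linarith
  obtain ⟨s, hs, hball⟩ := Metric.nhds_basis_closedBall.mem_iff.1
    ((isOpen_domainC ρ).mem_nhds (mem_domainC ha ha1))
  refine ⟨j.factorial * ((1 - ρ)⁻¹ * 2) / s ^ j, fun x => ?_⟩
  rw [Mfun, iteratedDeriv_eq_re (isOpen_domainC ρ) (differentiableOn_okamotoC h0 h1 x)
    (okamoto_eq_re x) j (mem_domainC ha ha1)]
  refine (Complex.abs_re_le_norm _).trans ?_
  refine Complex.norm_iteratedDeriv_le_of_forall_mem_sphere_norm_le j hs ?_ fun z hz =>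
    norm_okamotoC_le h0 h1 x (hball (Metric.sphere_subset_closedBall hz))
  refine DifferentiableOn.diffContOnCl_ball (U := domainC ρ)
    (differentiableOn_okamotoC h0 h1 x) hball

end OkamotoFun

/-- A triangular recursion whose solution grows at least linearly in the derivative order. -/
lemma triangular_recursion {Q : ℕ → ℕ → ℝ} {l l' : ℕ → ℝ} (hl : ∀ n, 0 ≤ l n)
    (hll : ∀ n, l n ≤ l' n) (h00 : Q 0 0 = 1) (h0 : ∀ j, Q 0 (j + 1) = 0)
    (hQ : ∀ n j, Q (n + 1) j = l n * Q n j + j * l' n * Q n (j - 1)) (n : ℕ) :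
    ∀ j, 0 ≤ Q n j ∧ ((n : ℝ) - j) * Q n j ≤ Q n (j + 1) := by
  induction n with
  | zero =>
    rintro (_ | j)
    · simp [h00, h0]
    · simp [h0]
  | succ n ih =>
    intro j
    have h1 := hl n
    have h2 := h1.trans (hll n)
    refine ⟨?_, ?_⟩
    · rw [hQ]
      have := (ih j).1
      have := (ih (j - 1)).1
      positivity
    · rw [hQ, hQ n (j + 1), Nat.add_sub_cancel]
      have e0 := ih j
      have e1 := mul_le_mul_of_nonneg_left e0.2 h1
      have e2 := mul_le_mul_of_nonneg_right (hll n) e0.1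
      have e3 : j * l' n * (((n : ℝ) + 1 - j) * Q n (j - 1)) ≤ j * l' n * Q n j := by
        rcases j with _ | j
        · simp
        · have := (ih j).2
          refine mul_le_mul_of_nonneg_left ?_ (by positivity)
          push_cast
          simpa using this
      push_cast
      linarith

lemma iteratedDeriv_mul_affine {f : ℝ → ℝ} (hf : ContDiff ℝ ⊤ f) (p q : ℝ) (j : ℕ) :
    iteratedDeriv j (fun b => f b * (p + q * b)) =
      fun b => iteratedDeriv j f b * (p + q * b) + j * q * iteratedDeriv (j - 1) f b := by
  have hd : ∀ (i : ℕ) b, HasDerivAt (iteratedDeriv i f) (iteratedDeriv (i + 1) f b) b :=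
    fun i b => by
      rw [iteratedDeriv_succ]
      exact ((hf.differentiable_iteratedDeriv i (by simp)) b).hasDerivAt
  induction j with
  | zero => simp
  | succ j ih =>
    funext b
    rw [iteratedDeriv_succ, ih]
    have h1 := (hd j b).mul (((hasDerivAt_id b).const_mul q).const_add p)
    have h2 := (hd (j - 1) b).const_mul (j * q)
    refine (h1.add h2).deriv.trans ?_
    rcases j with _ | j
    · simp; ring
    · simp; ring

namespace OkamotoFun

/-- The point with address `d 0, …, d (n - 1)` relative to `t`. -/
noncomputable def addr (d : ℕ → ℕ) : ℕ → ℝ → ℝ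
  | 0, t => t
  | n + 1, t => addr d n ((d n + t) / 3)

/-- The slope ratio of `F_b` on the ternary interval with address `d 0, …, d (n - 1)`. -/
noncomputable def slopeProd (d : ℕ → ℕ) (n : ℕ) (b : ℝ) : ℝ :=
  ∏ i ∈ Finset.range n, rDig b (d i)

/-- The sign of `slopeProd` for `b > 1 / 2`. -/
def signProd (d : ℕ → ℕ) (n : ℕ) : ℝ := ∏ i ∈ Finset.range n, if d i = 1 then -1 else 1

/-- The derivatives of `slopeProd` in the parameter, normalized to be nonnegative. -/
noncomputable def slopeDeriv (a : ℝ) (d : ℕ → ℕ) (n j : ℕ) : ℝ :=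
  signProd d n * iteratedDeriv j (slopeProd d n) a

variable {a : ℝ} {d : ℕ → ℕ} {xs : ℕ → ℝ}

lemma add_div_mem_Icc {i : ℕ} (hi : i < 3) {t : ℝ} (ht : t ∈ Icc (0 : ℝ) 1) :
    (i + t) / 3 ∈ Icc (0 : ℝ) 1 := by
  have hi' : (i : ℝ) ≤ 2 := by exact_mod_cast Nat.lt_succ_iff.1 hi
  have := ht.1
  exact ⟨by positivity, by linarith [ht.2]⟩

lemma addr_mem_Icc (hd : ∀ n, d n < 3) (n : ℕ) {t : ℝ} (ht : t ∈ Icc (0 : ℝ) 1) :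
    addr d n t ∈ Icc (0 : ℝ) 1 := by
  induction n generalizing t with
  | zero => exact ht
  | succ n ih => exact ih (add_div_mem_Icc (hd n) ht)

lemma addr_eq (d : ℕ → ℕ) (n : ℕ) (t : ℝ) : addr d n t = addr d n 0 + (1 / 3) ^ n * t := by
  induction n generalizing t with
  | zero => simp [addr]
  | succ n ih => rw [addr, addr, ih, ih ((d n + 0) / 3)]; ring

lemma okamoto_addr_sub {b : ℝ} (hb : b ∈ Ioo (0 : ℝ) 1) (hd : ∀ n, d n < 3) (n : ℕ) {t t' : ℝ}
    (ht : t ∈ Icc (0 : ℝ) 1) (ht' : t' ∈ Icc (0 : ℝ) 1) :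
    Okamoto b (addr d n t') - Okamoto b (addr d n t)
      = slopeProd d n b * (Okamoto b t' - Okamoto b t) := by
  induction n generalizing t t' with
  | zero => simp [addr, slopeProd]
  | succ n ih =>
    rw [addr, addr, ih (add_div_mem_Icc (hd n) ht) (add_div_mem_Icc (hd n) ht'),
      okamoto_add_div hb (hd n) ht, okamoto_add_div hb (hd n) ht', slopeProd, slopeProd,
      Finset.prod_range_succ]
    ring

lemma rDig_eq (b : ℝ) (i : ℕ) :
    rDig b i = (if i = 1 then 1 else 0) + (if i = 1 then -2 else 1) * b := by
  unfold rDig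
  split_ifs <;> ring

lemma contDiff_slopeProd (d : ℕ → ℕ) (n : ℕ) : ContDiff ℝ ⊤ (slopeProd d n) := by
  unfold slopeProd
  simp only [rDig_eq]
  fun_prop

lemma signProd_mul_self (d : ℕ → ℕ) (n : ℕ) : signProd d n * signProd d n = 1 := by
  rw [signProd, ← Finset.prod_mul_distrib]
  exact Finset.prod_eq_one fun i _ => by split_ifs <;> norm_num

lemma slopeDeriv_succ (a : ℝ) (d : ℕ → ℕ) (n j : ℕ) :
    slopeDeriv a d (n + 1) j = (if d n = 1 then 2 * a - 1 else a) * slopeDeriv a d n j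
      + j * (if d n = 1 then 2 else 1) * slopeDeriv a d n (j - 1) := by
  have h : slopeProd d (n + 1) = fun b => slopeProd d n b *
      ((if d n = 1 then 1 else 0) + (if d n = 1 then -2 else 1) * b) := by
    funext b
    rw [← rDig_eq, slopeProd, slopeProd, Finset.prod_range_succ]
  rw [slopeDeriv, h, iteratedDeriv_mul_affine (contDiff_slopeProd d n), signProd,
    Finset.prod_range_succ, ← signProd, slopeDeriv, slopeDeriv]
  split_ifs <;> ring

lemma slopeDeriv_nonneg_and_le (ha : 1 / 2 < a) (ha1 : a < 1) (d : ℕ → ℕ) (n j : ℕ) :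
    0 ≤ slopeDeriv a d n j ∧ ((n : ℝ) - j) * slopeDeriv a d n j ≤ slopeDeriv a d n (j + 1) := by
  refine triangular_recursion (l := fun n => if d n = 1 then 2 * a - 1 else a)
    (l' := fun n => if d n = 1 then 2 else 1) (fun n => ?_) (fun n => ?_) ?_ (fun j => ?_)
    (fun n j => slopeDeriv_succ a d n j) n j
  · split_ifs <;> linarith
  · split_ifs <;> linarith
  · simp [slopeDeriv, signProd, slopeProd]
  · have : slopeProd d 0 = fun _ => 1 := by funext b; simp [slopeProd]
    rw [slopeDeriv, this, iteratedDeriv_const]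
    simp

lemma slopeDeriv_zero_pos (ha : 1 / 2 < a) (d : ℕ → ℕ) (n : ℕ) : 0 < slopeDeriv a d n 0 := by
  induction n with
  | zero => simp [slopeDeriv, signProd, slopeProd]
  | succ n ih =>
    rw [slopeDeriv_succ]
    simp only [CharP.cast_eq_zero, zero_mul, add_zero]
    refine mul_pos ?_ ih
    split_ifs <;> linarith

lemma slopeDeriv_mono (ha : 1 / 2 < a) (ha1 : a < 1) (d : ℕ → ℕ) {n i j : ℕ} (hij : i ≤ j)
    (hj : j ≤ n) : slopeDeriv a d n i ≤ slopeDeriv a d n j := by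
  induction j, hij using Nat.le_induction with
  | base => rfl
  | succ j hij ih =>
    have h := slopeDeriv_nonneg_and_le ha ha1 d n j
    have hn : (j : ℝ) + 1 ≤ n := by exact_mod_cast hj
    have := ih (by omega)
    nlinarith

lemma slopeDeriv_pos (ha : 1 / 2 < a) (ha1 : a < 1) (d : ℕ → ℕ) {n k : ℕ} (hk : k ≤ n) :
    0 < slopeDeriv a d n k :=
  (slopeDeriv_zero_pos ha d n).trans_le (slopeDeriv_mono ha ha1 d (Nat.zero_le _) hk)

lemma mul_slopeDeriv_le (ha : 1 / 2 < a) (ha1 : a < 1) (d : ℕ → ℕ) {n j k : ℕ} (hjk : j < k)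
    (hk : k ≤ n) : ((n : ℝ) + 1 - k) * slopeDeriv a d n j ≤ slopeDeriv a d n k := by
  have h := slopeDeriv_nonneg_and_le ha ha1 d n j
  have hm := slopeDeriv_mono ha ha1 d (Nat.succ_le_of_lt hjk) hk
  have : (j : ℝ) + 1 ≤ k := by exact_mod_cast hjk
  rw [Nat.succ_eq_add_one] at hm
  nlinarith

lemma Mfun_addr_sub (ha : 1 / 2 < a) (ha1 : a < 1) (hd : ∀ n, d n < 3) (k n : ℕ) {t t' : ℝ}
    (ht : t ∈ Icc (0 : ℝ) 1) (ht' : t' ∈ Icc (0 : ℝ) 1) :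
    Mfun k a (addr d n t') - Mfun k a (addr d n t) = ∑ i ∈ Finset.range (k + 1),
      k.choose i * iteratedDeriv i (slopeProd d n) a * (Mfun (k - i) a t' - Mfun (k - i) a t) := by
  have hc := contDiffAt_okamoto ha ha1
  have he : (fun b => Okamoto b (addr d n t') - Okamoto b (addr d n t)) =ᶠ[𝓝 a]
      slopeProd d n * fun b => Okamoto b t' - Okamoto b t := by
    filter_upwards [Ioo_mem_nhds (by linarith : (0 : ℝ) < a) ha1] with b hb
    exact okamoto_addr_sub hb hd n ht ht'
  rw [Mfun, Mfun, ← iteratedDeriv_fun_sub (hc _ k) (hc _ k), he.iteratedDeriv_eq k,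
    iteratedDeriv_mul ((contDiff_slopeProd d n).contDiffAt.of_le le_top) ((hc _ k).sub (hc _ k))]
  refine Finset.sum_congr rfl fun i _ => ?_
  rw [iteratedDeriv_fun_sub (hc _ _) (hc _ _)]
  rfl

/-- The increments of `M_{k,a}` over ternary intervals are asymptotically proportional to the
increments of `F_a`. -/
lemma exists_abs_Mfun_addr_sub_le (ha : 1 / 2 < a) (ha1 : a < 1) (k : ℕ) :
    ∃ C : ℝ, 0 ≤ C ∧ ∀ d : ℕ → ℕ, (∀ n, d n < 3) → ∀ n, k ≤ n →
      ∀ t ∈ Icc (0 : ℝ) 1, ∀ t' ∈ Icc (0 : ℝ) 1,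
        |signProd d n * (Mfun k a (addr d n t') - Mfun k a (addr d n t))
          - slopeDeriv a d n k * (Okamoto a t' - Okamoto a t)|
          ≤ slopeDeriv a d n k * (C / ((n : ℝ) + 1 - k)) := by
  choose B hB using exists_abs_Mfun_le ha ha1
  have hB0 : ∀ j, 0 ≤ B j := fun j => (abs_nonneg _).trans (hB j 0)
  refine ⟨∑ i ∈ Finset.range k, k.choose i * (2 * B (k - i)),
    Finset.sum_nonneg fun i _ => by have := hB0 (k - i); positivity, ?_⟩
  intro d hd n hkn t ht t' ht'
  have hn : 0 < (n : ℝ) + 1 - k := by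
    have : (k : ℝ) ≤ n := by exact_mod_cast hkn
    linarith
  have h0 : ∀ x, Mfun 0 a x = Okamoto a x := fun x => by simp [Mfun]
  have heq : signProd d n * (Mfun k a (addr d n t') - Mfun k a (addr d n t))
      - slopeDeriv a d n k * (Okamoto a t' - Okamoto a t)
      = ∑ i ∈ Finset.range k, k.choose i * slopeDeriv a d n i *
        (Mfun (k - i) a t' - Mfun (k - i) a t) := by
    rw [Mfun_addr_sub ha ha1 hd k n ht ht', Finset.sum_range_succ, mul_add, Finset.mul_sum,
      Nat.sub_self, h0, h0, Nat.choose_self, slopeDeriv, Nat.cast_one, one_mul, ← mul_assoc,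
      add_sub_cancel_right]
    exact Finset.sum_congr rfl fun i _ => by rw [slopeDeriv]; ring
  rw [heq, Finset.sum_div, Finset.mul_sum]
  refine (Finset.abs_sum_le_sum_abs _ _).trans (Finset.sum_le_sum fun i hi => ?_)
  have h1 := slopeDeriv_nonneg_and_le ha ha1 d n i
  have h2 := mul_slopeDeriv_le ha ha1 d (Finset.mem_range.1 hi) hkn
  have h3 : |Mfun (k - i) a t' - Mfun (k - i) a t| ≤ 2 * B (k - i) := by
    have := abs_le.1 (hB (k - i) t)
    have := abs_le.1 (hB (k - i) t')
    rw [abs_le]; constructor <;> linarith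
  have h4 : slopeDeriv a d n i ≤ slopeDeriv a d n k / ((n : ℝ) + 1 - k) := by
    rw [le_div_iff₀ hn]; linarith
  rw [abs_mul, abs_mul, abs_of_nonneg h1.1, Nat.abs_cast]
  calc (k.choose i : ℝ) * slopeDeriv a d n i * |Mfun (k - i) a t' - Mfun (k - i) a t|
      ≤ k.choose i * (slopeDeriv a d n k / ((n : ℝ) + 1 - k)) * (2 * B (k - i)) := by
        gcongr
        exact mul_nonneg (Nat.cast_nonneg _) (h1.1.trans h4)
    _ = _ := by ring

/-- `xs` is the orbit of `xs 0` under the inverse ternary branches with digits `d`. -/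
def IsOrbit (d : ℕ → ℕ) (xs : ℕ → ℝ) : Prop :=
  ∀ n, d n < 3 ∧ xs n ∈ Icc (0 : ℝ) 1 ∧ xs n = (d n + xs (n + 1)) / 3

lemma exists_isOrbit {x : ℝ} (hx : x ∈ Icc (0 : ℝ) 1) : ∃ d xs, IsOrbit d xs ∧ xs 0 = x := by
  choose! i hi t ht h using fun x (hx : x ∈ Icc (0 : ℝ) 1) => exists_eq_add_div hx
  have hmem : ∀ n, t^[n] x ∈ Icc (0 : ℝ) 1 := fun n => by
    induction n with
    | zero => exact hx
    | succ n ih => rw [Function.iterate_succ_apply']; exact ht _ ih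
  refine ⟨fun n => i (t^[n] x), fun n => t^[n] x, fun n => ⟨hi _ (hmem n), hmem n, ?_⟩, rfl⟩
  simp only [Function.iterate_succ_apply']
  exact h _ (hmem n)

namespace IsOrbit

lemma addr_eq (h : IsOrbit d xs) (n : ℕ) : addr d n (xs n) = xs 0 := by
  induction n with
  | zero => rfl
  | succ n ih => rw [addr, ← (h n).2.2, ih]

lemma addr_sub (h : IsOrbit d xs) (n : ℕ) (t : ℝ) :
    addr d n t - xs 0 = (1 / 3) ^ n * (t - xs n) := by
  rw [← h.addr_eq n, OkamotoFun.addr_eq d n t, OkamotoFun.addr_eq d n (xs n)]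
  ring

end IsOrbit

lemma okamoto_third (ha : a ∈ Ioo (0 : ℝ) 1) : Okamoto a (1 / 3) = a := by
  simpa [okamoto_zero, qDig] using okamoto_add_div (i := 1) (t := 0) ha (by norm_num) (by simp)

lemma okamoto_two_thirds (ha : a ∈ Ioo (0 : ℝ) 1) : Okamoto a (2 / 3) = 1 - a := by
  simpa [okamoto_zero, qDig] using okamoto_add_div (i := 2) (t := 0) ha (by norm_num) (by simp)

lemma okamoto_ge_of_third_lt (ha : 1 / 2 < a) (ha1 : a < 1) {y : ℝ} (hy : y ∈ Icc (0 : ℝ) 1)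
    (h : 1 / 3 < y) : 1 - a ≤ Okamoto a y := by
  obtain ⟨i, hi, t, ht, rfl⟩ := exists_eq_add_div hy
  have := okamoto_mem_Icc ha ha1 ht
  rw [okamoto_add_div ⟨by linarith, ha1⟩ hi ht]
  interval_cases i
  · have := ht.2
    norm_num at h
    linarith
  · norm_num [qDig, rDig]; nlinarith [this.2]
  · norm_num [qDig, rDig]; nlinarith [this.1]

lemma okamoto_le_of_lt_two_thirds (ha : 1 / 2 < a) (ha1 : a < 1) {y : ℝ}
    (hy : y ∈ Icc (0 : ℝ) 1) (h : y < 2 / 3) : Okamoto a y ≤ a := by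
  obtain ⟨i, hi, t, ht, rfl⟩ := exists_eq_add_div hy
  have := okamoto_mem_Icc ha ha1 ht
  rw [okamoto_add_div ⟨by linarith, ha1⟩ hi ht]
  interval_cases i
  · norm_num [qDig, rDig]; nlinarith [this.2]
  · norm_num [qDig, rDig]; nlinarith [this.1]
  · have := ht.1
    norm_num at h
    linarith

lemma tendsto_div_add_one_sub (C : ℝ) (k : ℕ) :
    Tendsto (fun n : ℕ => C / ((n : ℝ) + 1 - k)) atTop (𝓝 0) := by
  refine tendsto_const_nhds.div_atTop ?_
  have := tendsto_natCast_atTop_atTop (R := ℝ) |>.atTop_add (tendsto_const_nhds (x := (1 : ℝ) - k))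
  exact this.congr fun n => by ring

/-- Near a point of infinite derivative, the function is strictly increasing through the point. -/
lemma eventually_lt_of_derivPInf (h : IsOrbit d xs) {G : ℝ → ℝ} (hG : derivPInf G (xs 0)) :
    ∀ᶠ n in atTop, ∀ t ∈ Icc (0 : ℝ) 1,
      (t < xs n → G (addr d n t) < G (xs 0)) ∧ (xs n < t → G (xs 0) < G (addr d n t)) := by
  obtain ⟨s, hs, hpos⟩ := Metric.eventually_nhds_iff.1
    (eventually_nhdsWithin_iff.1 (hG.eventually_gt_atTop 0))
  filter_upwards [(tendsto_pow_atTop_nhds_zero_of_lt_one (by norm_num : (0 : ℝ) ≤ 1 / 3)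
    (by norm_num)).eventually_lt_const hs] with n hn t ht
  have h3 : (0 : ℝ) < (1 / 3) ^ n := by positivity
  have hsub := h.addr_sub n t
  have hx := (h n).2.1
  have hdist : dist (addr d n t) (xs 0) < s := by
    rw [Real.dist_eq, hsub, abs_mul, abs_of_pos h3]
    have : |t - xs n| ≤ 1 := by
      rw [abs_le]; constructor <;> linarith [ht.1, ht.2, hx.1, hx.2]
    nlinarith
  have hmem := addr_mem_Icc (fun n => (h n).1) n ht
  constructor
  · intro hlt
    have hneg : addr d n t - xs 0 < 0 := by rw [hsub]; exact mul_neg_of_pos_of_neg h3 (by linarith)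
    have := hpos hdist ⟨hmem, fun he => by rw [mem_singleton_iff.1 he] at hneg; linarith⟩
    rcases div_pos_iff.1 this with ⟨_, h2⟩ | ⟨h2, _⟩ <;> linarith
  · intro hlt
    have hneg : 0 < addr d n t - xs 0 := by rw [hsub]; exact mul_pos h3 (by linarith)
    have := hpos hdist ⟨hmem, fun he => by rw [mem_singleton_iff.1 he] at hneg; linarith⟩
    rcases div_pos_iff.1 this with ⟨h2, _⟩ | ⟨_, h2⟩ <;> linarith

lemma eventually_of_derivPInf (ha : 1 / 2 < a) (ha1 : a < 1) {k : ℕ} {τ : ℝ} (hτ : τ * τ = 1)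
    (h : IsOrbit d xs) (hG : derivPInf (fun y => τ * Mfun k a y) (xs 0)) :
    (∀ᶠ n in atTop, signProd d n = τ) ∧ ∀ η > 0, ∀ᶠ n in atTop,
      (d n = 0 → Okamoto a (xs n) ≤ 1 - a + η) ∧ (d n = 2 → a - η ≤ Okamoto a (xs n)) := by
  have hb : a ∈ Ioo (0 : ℝ) 1 := ⟨by linarith, ha1⟩
  obtain ⟨C, hC, hkey⟩ := exists_abs_Mfun_addr_sub_le ha ha1 k
  have hinc := eventually_lt_of_derivPInf h hG
  have hd : ∀ n, d n < 3 := fun n => (h n).1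
  have hsign : ∀ᶠ n in atTop, signProd d n = τ := by
    filter_upwards [hinc, (tendsto_div_add_one_sub C k).eventually_lt_const one_pos,
      eventually_ge_atTop k] with n hn hCn hkn
    have hQ := slopeDeriv_pos ha ha1 d hkn
    have h1 := abs_le.1 (hkey d hd n hkn 0 (by simp) 1 (by simp))
    rw [okamoto_one hb, okamoto_zero] at h1
    have hx := (h n).2.1
    have hlt : τ * Mfun k a (addr d n 0) < τ * Mfun k a (addr d n 1) := by
      rcases hx.1.lt_or_eq with h2 | h2
      · refine ((hn 0 (by simp)).1 h2).trans_le ?_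
        rcases hx.2.lt_or_eq with h3 | h3
        · exact ((hn 1 (by simp)).2 h3).le
        · rw [← h3, h.addr_eq]
      · have := (hn 1 (by simp)).2 (by linarith)
        rwa [h2, h.addr_eq]
    have hpos : 0 < signProd d n * (Mfun k a (addr d n 1) - Mfun k a (addr d n 0)) := by
      nlinarith
    rcases mul_self_eq_one_iff.1 (signProd_mul_self d n) with e | e <;>
      rcases mul_self_eq_one_iff.1 hτ with e' | e' <;> rw [e] at hpos <;> rw [e'] at hlt <;>
      first | exact e.trans e'.symm | (exfalso; linarith)
  refine ⟨hsign, fun η hη => ?_⟩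
  filter_upwards [hinc, (tendsto_div_add_one_sub C k).eventually_lt_const hη,
    eventually_ge_atTop k, hsign] with n hn hCn hkn hs
  have hQ := slopeDeriv_pos ha ha1 d hkn
  obtain ⟨_, hx, hxn⟩ := h n
  have hx' := (h (n + 1)).2.1
  constructor
  · intro h0
    have h1 := abs_le.1 (hkey d hd n hkn _ hx (2 / 3) (by norm_num))
    rw [okamoto_two_thirds hb, hs, h.addr_eq] at h1
    have h2 := (hn (2 / 3) (by norm_num)).2 (by rw [hxn, h0]; push_cast; linarith [hx'.2])
    by_contra! hcon
    nlinarith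
  · intro h0
    have h1 := abs_le.1 (hkey d hd n hkn (1 / 3) (by norm_num) _ hx)
    rw [okamoto_third hb, hs, h.addr_eq] at h1
    have h2 := (hn (1 / 3) (by norm_num)).1 (by rw [hxn, h0]; push_cast; linarith [hx'.1])
    by_contra! hcon
    nlinarith

lemma tendsto_pow_mul_slopeDeriv (ha : 1 / 2 < a) {N : ℕ} (hN : ∀ n ≥ N, d n ≠ 1) :
    Tendsto (fun n => 3 ^ n * slopeDeriv a d n 0) atTop atTop := by
  have h : ∀ m, 3 ^ (m + N) * slopeDeriv a d (m + N) 0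
      = (3 * a) ^ m * (3 ^ N * slopeDeriv a d N 0) := by
    intro m
    induction m with
    | zero => simp
    | succ m ih =>
      rw [show m + 1 + N = m + N + 1 by ring, slopeDeriv_succ, if_neg (hN _ (by omega))]
      simp only [Nat.cast_zero, zero_mul, add_zero]
      linear_combination 3 * a * ih
  rw [← tendsto_add_atTop_iff_nat N]
  refine Tendsto.congr (fun m => (h m).symm) ?_
  have := slopeDeriv_zero_pos ha d N
  exact (tendsto_pow_atTop_atTop_of_one_lt (by linarith)).atTop_mul_const (by positivity)

/-- A symbolic criterion for an infinite derivative. -/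
lemma derivPInf_of_orbit (ha : 1 / 2 < a) (ha1 : a < 1) (k : ℕ) (h : IsOrbit d xs) {σ ε : ℝ}
    (hε : 0 < ε) {N : ℕ} (hσ : ∀ n ≥ N, signProd d n = σ) (hx : ∀ n ≥ N, xs n ∈ Ioo (0 : ℝ) 1)
    (hN : ∀ n ≥ N, d n = 0 ∧ Okamoto a (xs n) ≤ 1 - a - ε ∨
      d n = 2 ∧ a + ε ≤ Okamoto a (xs n)) :
    derivPInf (fun y => σ * Mfun k a y) (xs 0) := by
  obtain ⟨C, hC, hkey⟩ := exists_abs_Mfun_addr_sub_le ha ha1 k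
  have hd : ∀ n, d n < 3 := fun n => (h n).1
  rw [derivPInf, tendsto_atTop]
  intro L
  have hslope := tendsto_pow_mul_slopeDeriv (d := d) ha (N := N) fun n hn => by
    rcases hN n hn with ⟨h', -⟩ | ⟨h', -⟩ <;> rw [h'] <;> norm_num
  obtain ⟨n₁, hn₁⟩ := eventually_atTop.1
    ((((tendsto_div_add_one_sub C k).eventually_lt_const (half_pos hε)).and
      (eventually_ge_atTop (max k N))).and
      ((hslope.atTop_mul_const (half_pos hε)).eventually_ge_atTop L))
  have hxn₁ := hx n₁ (le_of_max_le_right (hn₁ n₁ le_rfl).1.2)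
  have hzoom : ∀ y n, addr d n (xs n + 3 ^ n * (y - xs 0)) = y := by
    intro y n
    have := h.addr_sub n (xs n + 3 ^ n * (y - xs 0))
    rw [add_sub_cancel_left, ← mul_assoc, ← mul_pow] at this
    norm_num at this
    exact this
  have hev : ∀ᶠ y in 𝓝 (xs 0), xs n₁ + 3 ^ n₁ * (y - xs 0) ∈ Ioo (0 : ℝ) 1 := by
    have hc : Continuous fun y => xs n₁ + 3 ^ n₁ * (y - xs 0) := by fun_prop
    exact hc.continuousAt.eventually (Ioo_mem_nhds (by simpa using hxn₁.1) (by simpa using hxn₁.2))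
  filter_upwards [nhdsWithin_le_nhds hev, self_mem_nhdsWithin] with y hy hyx
  have hne : y - xs 0 ≠ 0 := sub_ne_zero.2 fun e => hyx.2 (mem_singleton_iff.2 e)
  have hex : ∃ m, xs (n₁ + m) + 3 ^ (n₁ + m) * (y - xs 0) ∉ Icc (0 : ℝ) 1 := by
    by_contra! hcon
    obtain ⟨m, hm⟩ := pow_unbounded_of_one_lt (1 / |y - xs 0|) (by norm_num : (1 : ℝ) < 3)
    rw [div_lt_iff₀ (abs_pos.2 hne)] at hm
    have h1 := hcon m
    have h2 := (h (n₁ + m)).2.1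
    have h3 : |3 ^ (n₁ + m) * (y - xs 0)| ≤ 1 := by
      rw [abs_le]; constructor <;> linarith [h1.1, h1.2, h2.1, h2.2]
    rw [abs_mul, abs_of_pos (by positivity)] at h3
    have h4 : (3 : ℝ) ^ m ≤ 3 ^ (n₁ + m) := pow_le_pow_right₀ (by norm_num) (by omega)
    have := mul_le_mul_of_nonneg_right h4 (abs_nonneg (y - xs 0))
    linarith
  classical
  obtain ⟨m, hm⟩ : ∃ m, Nat.find hex = m + 1 :=
    Nat.exists_eq_succ_of_ne_zero fun e => by
      have := Nat.find_spec hex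
      rw [e] at this
      exact this (Ioo_subset_Icc_self hy)
  have hout := Nat.find_spec hex
  have hin := not_not.1 (Nat.find_min hex (m := m) (by omega))
  rw [hm, ← add_assoc] at hout
  set n := n₁ + m with hn
  obtain ⟨⟨hCn, hnk⟩, hL⟩ := hn₁ n (by omega)
  have hkn : k ≤ n := le_of_max_le_left hnk
  obtain ⟨-, hxn, hxs⟩ := h n
  have hxn' := (h (n + 1)).2.1
  set z := xs n + 3 ^ n * (y - xs 0) with hz
  have hz' : xs (n + 1) + 3 ^ (n + 1) * (y - xs 0) = 3 * z - d n := by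
    rw [hz, hxs]; ring
  have hyz : y - xs 0 = (1 / 3) ^ n * (z - xs n) := by
    rw [← h.addr_sub n z, hzoom]
  have hQ : L ≤ 3 ^ n * (slopeDeriv a d n k * (ε / 2)) := by
    refine hL.trans ?_
    have := slopeDeriv_mono ha ha1 d (Nat.zero_le k) hkn
    rw [mul_assoc]
    gcongr
  have hQ0 := slopeDeriv_pos ha ha1 d hkn
  have h3 : (0 : ℝ) < (1 / 3) ^ n := by positivity
  have hquot : ∀ A D : ℝ, 0 < D → D ≤ (1 / 3) ^ n → slopeDeriv a d n k * (ε / 2) ≤ A →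
      L ≤ A / D := by
    intro A D hD hD1 hA
    have h0 : 0 ≤ slopeDeriv a d n k * (ε / 2) := by positivity
    calc L ≤ 3 ^ n * (slopeDeriv a d n k * (ε / 2)) := hQ
      _ = slopeDeriv a d n k * (ε / 2) / (1 / 3) ^ n := by
        rw [one_div, inv_pow, div_inv_eq_mul, mul_comm]
      _ ≤ A / D := by
        gcongr
        exact h0.trans hA
  have hb := abs_le.1 (hkey d hd n hkn _ hxn _ hin)
  rw [h.addr_eq, hzoom, hσ n (le_of_max_le_right hnk)] at hb
  rw [hz'] at hout
  rcases hN n (le_of_max_le_right hnk) with ⟨h0, hF⟩ | ⟨h2, hF⟩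
  · have hz3 : 1 / 3 < z := by
      by_contra! hcon
      refine hout ⟨?_, ?_⟩ <;> rw [h0] <;> push_cast <;> linarith [hin.1]
    rw [h0] at hxs
    push_cast at hxs
    have hlt : xs n < z := by linarith [hxn'.2]
    have := okamoto_ge_of_third_lt ha ha1 hin hz3
    refine hquot _ _ (hyz ▸ mul_pos h3 (by linarith)) ?_ ?_
    · rw [hyz]; exact mul_le_of_le_one_right h3.le (by linarith [hxn.1, hin.2])
    · nlinarith
  · have hz3 : z < 2 / 3 := by
      by_contra! hcon
      refine hout ⟨?_, ?_⟩ <;> rw [h2] <;> push_cast <;> linarith [hin.2]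
    rw [h2] at hxs
    push_cast at hxs
    have hlt : z < xs n := by linarith [hxn'.1]
    have := okamoto_le_of_lt_two_thirds ha ha1 hin hz3
    rw [← neg_div_neg_eq]
    refine hquot _ _ ?_ ?_ ?_
    · rw [hyz, ← mul_neg]; exact mul_pos h3 (by linarith)
    · rw [hyz, ← mul_neg]; exact mul_le_of_le_one_right h3.le (by linarith [hxn.2, hin.1])
    · nlinarith

open SignSeq

variable {c : ℕ → Bool}

lemma IsOrbit.eq_val_third (h : IsOrbit d xs) (hdc : ∀ n, d n = if c n then 2 else 0) (n : ℕ) :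
    xs n = 1 / 2 + val (1 / 3) (shift n c) := by
  have := val_eq_of_recursion (ρ := 1 / 3) (c := c) (u := fun n => xs n - 1 / 2) (B := 1 / 2)
    (by norm_num) (by norm_num) (fun n => ?_) (fun n => ?_) n
  · rw [this]; ring
  · have := (h n).2.1
    rw [abs_le]; constructor <;> linarith [this.1, this.2]
  · rw [(h n).2.2, hdc]
    cases c n <;> simp <;> ring

lemma IsOrbit.okamoto_eq (ha : 1 / 2 < a) (ha1 : a < 1) (h : IsOrbit d xs)
    (hdc : ∀ n, d n = if c n then 2 else 0) (n : ℕ) :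
    Okamoto a (xs n) = 1 / 2 + (1 - a) / (2 * a) * val a (shift n c) := by
  have h1 : 0 < 1 - a := by linarith
  have h2 : 0 < a := by linarith
  have := val_eq_of_recursion (ρ := a) (c := c)
    (u := fun n => 2 * a / (1 - a) * (Okamoto a (xs n) - 1 / 2)) (B := 2 * a / (1 - a) * (1 / 2))
    h2 ha1 (fun n => ?_) (fun n => ?_) n
  · rw [this]; field_simp; ring
  · rw [abs_mul, abs_of_pos (by positivity)]
    gcongr
    exact abs_okamoto_sub_half_le ha ha1 (h n).2.1
  · have hF : Okamoto a (xs n) = qDig a (d n) + rDig a (d n) * Okamoto a (xs (n + 1)) := by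
      rw [(h n).2.2]
      exact okamoto_add_div ⟨h2, ha1⟩ (h n).1 (h (n + 1)).2.1
    simp only [hF, hdc]
    cases c n <;> simp [qDig, rDig] <;> field_simp <;> ring

lemma isOrbit_of_seq (c : ℕ → Bool) :
    IsOrbit (fun n => if c n then 2 else 0) (fun n => 1 / 2 + val (1 / 3) (shift n c)) := by
  intro n
  have h := abs_le.1 (abs_val_le (ρ := 1 / 3) (by norm_num) (by norm_num) (shift n c))
  norm_num at h
  refine ⟨by dsimp only; split_ifs <;> norm_num, ⟨by linarith, by linarith⟩, ?_⟩
  dsimp only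
  rw [val_shift_step (by norm_num) (by norm_num) c n]
  cases c n <;> simp <;> ring

lemma IsOrbit.tail (h : IsOrbit d xs) (N : ℕ) :
    IsOrbit (fun n => d (N + n)) (fun n => xs (N + n)) := fun n => h (N + n)

lemma IsOrbit.cons (h : IsOrbit d xs) {i : ℕ} (hi : i < 3) :
    IsOrbit (fun n => Nat.casesOn n i d) (fun n => Nat.casesOn n ((i + xs 0) / 3) xs) := by
  rintro (_ | n)
  · exact ⟨hi, add_div_mem_Icc hi (h 0).2.1, rfl⟩
  · exact h n

lemma exists_rat_addr (d : ℕ → ℕ) (n : ℕ) (q : ℚ) : ∃ q' : ℚ, addr d n q = q' := by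
  induction n generalizing q with
  | zero => exact ⟨q, rfl⟩
  | succ n ih =>
    obtain ⟨q', hq'⟩ := ih ((d n + q) / 3)
    refine ⟨q', ?_⟩
    rw [← hq', addr]
    push_cast
    rfl

/-- The critical value for the tails. -/
noncomputable def crit (a : ℝ) : ℝ := (2 - 3 * a) / (1 - a)

lemma crit_eq (ha1 : a < 1) : crit a = 2 - a / (1 - a) := by
  have : 1 - a ≠ 0 := by linarith
  unfold crit
  field_simp
  ring

lemma one_lt_div_one_sub (ha : 1 / 2 < a) (ha1 : a < 1) : 1 < a / (1 - a) := by
  rw [lt_div_iff₀ (by linarith)]; linarith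

lemma crit_lt_one (ha : 1 / 2 < a) (ha1 : a < 1) : crit a < 1 := by
  rw [crit_eq ha1]; linarith [one_lt_div_one_sub ha ha1]

/-- Points with infinite derivative come from sequences that are asymptotically within `crit a`. -/
lemma dimH_setOf_derivPInf_le (ha : 1 / 2 < a) (ha1 : a < 1) {k : ℕ} {τ : ℝ} (hτ : τ * τ = 1) :
    dimH {x ∈ Ioo (0 : ℝ) 1 | derivPInf (fun y => τ * Mfun k a y) x}
      ≤ dimH (val (1 / 3) '' eventuallyWithin a (crit a)) := by
  refine dimH_le_of_subset_iUnion_affine (ι := ℚ × ℕ) (fun i => i.1 + (1 / 3) ^ i.2 * (1 / 2))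
    (fun i => (1 / 3) ^ i.2) ?_
  rintro x ⟨hx, hG⟩
  obtain ⟨d, xs, h, rfl⟩ := exists_isOrbit (Ioo_subset_Icc_self hx)
  obtain ⟨hsign, hF⟩ := eventually_of_derivPInf ha ha1 hτ h hG
  have hne : ∀ᶠ n in atTop, d n ≠ 1 := by
    filter_upwards [hsign, (tendsto_add_atTop_nat 1).eventually hsign] with n h1 h2 h3
    rw [signProd, Finset.prod_range_succ, ← signProd, h1, if_pos h3] at h2
    have : τ = 0 := by linarith
    rw [this] at hτ
    norm_num at hτ
  obtain ⟨N, hN⟩ := eventually_atTop.1 hne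
  set c : ℕ → Bool := fun n => decide (d (N + n) = 2) with hc
  have hdc : ∀ n, d (N + n) = if c n then 2 else 0 := fun n => by
    have h1 := hN (N + n) (by omega)
    have h2 := (h (N + n)).1
    by_cases h3 : d (N + n) = 2
    · simp [hc, h3]
    · simp only [hc, h3, decide_false, Bool.false_eq_true, if_false]; omega
  have hT := h.tail N
  obtain ⟨q, hq⟩ := exists_rat_addr d N 0
  refine ⟨(q, N), val (1 / 3) c, ⟨c, ?_, rfl⟩, ?_⟩
  · intro η hη
    have h1 : 0 < 1 - a := by linarith
    obtain ⟨M, hM⟩ := eventually_atTop.1 (hF (η * (1 - a) / 2) (by positivity))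
    refine ⟨M, fun n hn => ?_⟩
    have h2 := hM (N + n) (by omega)
    have h3 := hT.okamoto_eq ha ha1 hdc n
    rw [val_shift_step (by linarith) ha1 c n] at h3
    have h4 : ∀ s w : ℝ,
        1 / 2 + (1 - a) / (2 * a) * (a * (s + w)) = 1 / 2 + (1 - a) / 2 * (s + w) :=
      fun s w => by
        have : a ≠ 0 := by linarith
        field_simp
    rw [h3, h4, hdc n] at h2
    have h5 : crit a * (1 - a) = 2 - 3 * a := by rw [crit]; field_simp
    constructor <;> intro h6 <;> simp only [h6, sgn_true, sgn_false] at h2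
    · have := h2.1 (by simp)
      nlinarith
    · have := h2.2 (by simp)
      nlinarith
  · have := hT.eq_val_third hdc 0
    rw [shift_zero] at this
    rw [← h.addr_eq N, addr_eq, ← Rat.cast_zero, hq]
    dsimp only at this ⊢
    rw [add_zero] at this
    rw [this]
    ring

lemma okamoto_conditions (ha : 1 / 2 < a) (ha1 : a < 1) {ε : ℝ} (hε : 0 < ε)
    (h : IsOrbit d xs) (hdc : ∀ n, d n = if c n then 2 else 0)
    (hc : c ∈ tailsWithin a (crit a - ε)) (n : ℕ) : xs n ∈ Ioo (0 : ℝ) 1 ∧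
      (d n = 0 ∧ Okamoto a (xs n) ≤ 1 - a - (1 - a) * ε / 2 ∨
        d n = 2 ∧ a + (1 - a) * ε / 2 ≤ Okamoto a (xs n)) := by
  have hF := h.okamoto_eq ha ha1 hdc n
  have h1 : 0 < 1 - a := by linarith
  have h2 : 0 < a := by linarith
  have hcrit := crit_lt_one ha ha1
  constructor
  · have hw := abs_le.1 (hc n)
    have hs : 0 < (1 - a) / (2 * a) := by positivity
    have hs' : (1 - a) / (2 * a) < 1 / 2 := by rw [div_lt_iff₀ (by positivity)]; linarith
    obtain ⟨-, hx, -⟩ := h n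
    refine ⟨hx.1.lt_of_ne fun e => ?_, hx.2.lt_of_ne fun e => ?_⟩
    · rw [← e, okamoto_zero] at hF
      nlinarith
    · rw [e, okamoto_one ⟨h2, ha1⟩] at hF
      nlinarith
  · have hw := abs_le.1 (hc (n + 1))
    rw [val_shift_step h2 ha1 c n] at hF
    have h4 : (1 - a) / (2 * a) * (a * (sgn (c n) + val a (shift (n + 1) c)))
        = (1 - a) / 2 * (sgn (c n) + val a (shift (n + 1) c)) := by field_simp
    have h5 : crit a * (1 - a) = 2 - 3 * a := by rw [crit]; field_simp
    rw [h4] at hF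
    rw [hF, hdc]
    cases c n
    · left; simp only [sgn_false]; refine ⟨by simp, by nlinarith⟩
    · right; simp only [sgn_true]; refine ⟨by simp, by nlinarith⟩

lemma dimH_image_val_le_derivPInf (ha : 1 / 2 < a) (ha1 : a < 1) (k : ℕ) {ε : ℝ} (hε : 0 < ε)
    {Y : Set (ℕ → Bool)} (hY : Y ⊆ tailsWithin a (crit a - ε)) :
    dimH (val (1 / 3) '' Y)
      ≤ dimH {x ∈ Ioo (0 : ℝ) 1 | derivPInf (fun y => 1 * Mfun k a y) x} := by
  refine dimH_le_of_subset_iUnion_affine (ι := Unit) (fun _ => -(1 / 2)) (fun _ => 1) ?_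
  rintro _ ⟨c, hc, rfl⟩
  have h := isOrbit_of_seq c
  have hcond := okamoto_conditions ha ha1 hε h (fun _ => rfl) (hY hc)
  have hd := derivPInf_of_orbit ha ha1 k h (σ := 1) (ε := (1 - a) * ε / 2) (N := 0)
    (by have : 0 < 1 - a := by linarith
        positivity)
    (fun n _ => Finset.prod_eq_one fun i _ => if_neg (by dsimp only; split_ifs <;> norm_num))
    (fun n _ => (hcond n).1) (fun n _ => (hcond n).2)
  have h0 := (hcond 0).1
  rw [shift_zero] at h0 hd
  exact ⟨(), _, ⟨h0, hd⟩, by ring⟩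

lemma dimH_image_val_le_derivPInf_neg (ha : 1 / 2 < a) (ha1 : a < 1) (k : ℕ) {ε : ℝ} (hε : 0 < ε)
    {Y : Set (ℕ → Bool)} (hY : Y ⊆ tailsWithin a (crit a - ε)) :
    dimH (val (1 / 3) '' Y)
      ≤ dimH {x ∈ Ioo (0 : ℝ) 1 | derivPInf (fun y => -1 * Mfun k a y) x} := by
  refine dimH_le_of_subset_iUnion_affine (ι := Unit) (fun _ => -(3 / 2)) (fun _ => 3) ?_
  rintro _ ⟨c, hc, rfl⟩
  have h := isOrbit_of_seq c
  have hcond := okamoto_conditions ha ha1 hε h (fun _ => rfl) (hY hc)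
  have hd := derivPInf_of_orbit ha ha1 k (h.cons (i := 1) (by norm_num)) (σ := -1)
    (ε := (1 - a) * ε / 2) (N := 1)
    (by have : 0 < 1 - a := by linarith
        positivity)
    (fun n hn => by
      obtain ⟨n, rfl⟩ := Nat.exists_eq_succ_of_ne_zero (Nat.one_le_iff_ne_zero.1 hn)
      rw [signProd, Finset.prod_range_succ',
        Finset.prod_eq_one fun i _ => if_neg (by dsimp only; split_ifs <;> norm_num)]
      simp)
    (fun n hn => by
      obtain ⟨n, rfl⟩ := Nat.exists_eq_succ_of_ne_zero (Nat.one_le_iff_ne_zero.1 hn)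
      exact (hcond n).1)
    (fun n hn => by
      obtain ⟨n, rfl⟩ := Nat.exists_eq_succ_of_ne_zero (Nat.one_le_iff_ne_zero.1 hn)
      exact (hcond n).2)
  have h0 := (hcond 0).1
  rw [shift_zero] at h0
  have hd' : derivPInf (fun y => -1 * Mfun k a y)
      ((((1 : ℕ) : ℝ) + (1 / 2 + val (1 / 3) c)) / 3) := by
    have := hd
    simp only [shift_zero] at this
    exact this
  refine ⟨(), _, ⟨⟨?_, ?_⟩, hd'⟩, ?_⟩
  · have := h0.1
    positivity
  · have := h0.2
    push_cast
    linarith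
  · push_cast
    ring

lemma derivMInf_iff (f : ℝ → ℝ) (x : ℝ) : derivMInf f x ↔ derivPInf (fun y => -1 * f y) x := by
  rw [derivMInf, derivPInf, ← tendsto_neg_atTop_iff]
  refine tendsto_congr fun y => ?_
  ring

/-- The digit sequence in `{0, 1}` of a boolean sequence. -/
def digits (c : ℕ → Bool) : ℕ → ℕ := fun n => if c n then 1 else 0

lemma digits_injective : Function.Injective digits := fun c d h => by
  ext n
  have := congrFun h n
  cases hc : c n <;> cases hd : d n <;> simp_all [digits]

lemma tsum_digits (h0 : 0 < a) (h1 : a < 1) (c : ℕ → Bool) :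
    ∑' n, (digits c n : ℝ) / (1 / a) ^ (n + 1) = (a / (1 - a) + val a c) / 2 := by
  have hs : HasSum (fun n : ℕ => a ^ (n + 1)) (a / (1 - a)) := by
    have := (hasSum_geometric_of_lt_one h0.le h1).mul_left a
    simpa [pow_succ', div_eq_mul_inv] using this
  refine HasSum.tsum_eq ?_
  refine ((hs.add (summable_val h0 h1 c).hasSum).div_const 2).congr_fun fun n => ?_
  rw [one_div, inv_pow, div_inv_eq_mul]
  cases h : c n <;> simp [digits, h]

lemma isBetaExp_iff (h0 : 0 < a) (h1 : a < 1) {y : ℝ} {e : ℕ → ℕ} :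
    IsBetaExp (1 / a) y e ↔ ∃ c, e = digits c ∧ y = (a / (1 - a) + val a c) / 2 := by
  constructor
  · rintro ⟨he, hy⟩
    have hd : e = digits fun n => decide (e n = 1) := by
      ext n
      have := he n
      simp only [digits, decide_eq_true_eq]
      split_ifs <;> omega
    rw [hd, tsum_digits h0 h1] at hy
    exact ⟨_, hd, hy⟩
  · rintro ⟨c, rfl, rfl⟩
    refine ⟨fun n => ?_, (tsum_digits h0 h1 c).symm⟩
    dsimp only [digits]
    split_ifs <;> norm_num

lemma mem_univoque_iff (h0 : 0 < a) (h1 : a < 1) {y : ℝ} :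
    y ∈ univoque (1 / a) ↔
      ∃ c, y = (a / (1 - a) + val a c) / 2 ∧ ∀ c', val a c' = val a c → c' = c := by
  constructor
  · rintro ⟨-, e, he, hu⟩
    obtain ⟨c, rfl, hy⟩ := (isBetaExp_iff h0 h1).1 he
    refine ⟨c, hy, fun c' hc' => digits_injective (hu _ ((isBetaExp_iff h0 h1).2 ⟨c', rfl, ?_⟩))⟩
    rw [hy, hc']
  · rintro ⟨c, rfl, hu⟩
    have hb := abs_le.1 (abs_val_le h0 h1 c)
    have h2 : 1 / (1 / a - 1) = a / (1 - a) := by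
      have : 1 - a ≠ 0 := by linarith
      field_simp
    refine ⟨⟨by linarith, by rw [h2]; linarith⟩, digits c,
      (isBetaExp_iff h0 h1).2 ⟨c, rfl, rfl⟩, ?_⟩
    intro e he
    obtain ⟨c', rfl, hc'⟩ := (isBetaExp_iff h0 h1).1 he
    rw [hu c' (by linarith)]

/-- A sequence which is the only one with its value has all its tails below `crit a` after a
digit `false`. -/
lemma val_shift_lt_crit (ha : 1 / 2 < a) (ha1 : a < 1) (hu : ∀ c', val a c' = val a c → c' = c)
    {n : ℕ} (hn : c n = false) : val a (shift (n + 1) c) < crit a := by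
  have h0 : 0 < a := by linarith
  by_contra! h
  have hb := abs_le.1 (abs_val_le h0 ha1 (shift (n + 1) c))
  rw [crit_eq ha1] at h
  obtain ⟨e, he, -⟩ := exists_val_eq h0 ha1 (one_lt_div_one_sub ha ha1).le
    (div_mul_cancel₀ _ (by linarith)).le (y := val a (shift (n + 1) c) - 2)
    (abs_le.2 ⟨by linarith, by linarith⟩)
  let c' : ℕ → Bool := fun i => if i < n then c i else if i = n then true else e (i - (n + 1))
  have hc'n : c' n = true := by simp [c']
  have hs : shift (n + 1) c' = e := by
    ext i
    simp only [shift, c']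
    rw [if_neg (by omega), if_neg (by omega), Nat.add_sub_cancel_left]
  have hv := val_sub_val h0 ha1 (c := c) (d := c') (n := n) (fun i hi => by simp [c', hi]) hn hc'n
  rw [hs, he] at hv
  have := congrFun (hu c' (by linarith)) n
  rw [hn, hc'n] at this
  cases this

lemma neg_neg_seq (c : ℕ → Bool) : neg (neg c) = c := by
  ext i; simp [neg]

lemma mem_eventuallyWithin_of_unique (ha : 1 / 2 < a) (ha1 : a < 1)
    (hu : ∀ c', val a c' = val a c → c' = c) : c ∈ eventuallyWithin a (crit a) := by
  refine fun η hη => ⟨0, fun n _ => ⟨fun hn => ?_, fun hn => ?_⟩⟩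
  · linarith [val_shift_lt_crit ha ha1 hu hn]
  · have hu' : ∀ c', val a c' = val a (neg c) → c' = neg c := fun c' hc' => by
      rw [← hu (neg c') (by rw [val_neg, hc', val_neg, neg_neg]), neg_neg_seq]
    have := val_shift_lt_crit ha ha1 hu' (n := n) (by simp [neg, hn])
    rw [shift_neg, val_neg] at this
    linarith

lemma unique_of_mem_tailsWithin (h0 : 0 < a) (ha1 : a < 1) {ε : ℝ} (hε : 0 < ε)
    (hc : c ∈ tailsWithin a (crit a - ε)) {c' : ℕ → Bool} (h : val a c' = val a c) : c' = c := by
  rw [crit_eq ha1] at hc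
  rcases lt_trichotomy c' c with h' | ⟨n, hn, h1, h2⟩ | ⟨n, hn, h1, h2⟩
  · exact h'
  all_goals
    have hv := val_sub_val h0 ha1 hn h1 h2
    have hb := abs_le.1 (hc (n + 1))
    have hb' := abs_le.1 (abs_val_le h0 ha1 (shift (n + 1) c'))
    rw [h, sub_self, eq_comm, mul_eq_zero] at hv
    rcases hv with hv | hv
    · exact absurd hv (by positivity)
    · linarith

lemma dimH_univoque_le (ha : 1 / 2 < a) (ha1 : a < 1) :
    dimH (univoque (1 / a)) ≤ dimH (val a '' eventuallyWithin a (crit a)) := by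
  refine dimH_le_of_subset_iUnion_affine (ι := Unit) (fun _ => a / (1 - a) / 2) (fun _ => 1 / 2) ?_
  intro y hy
  obtain ⟨c, rfl, hu⟩ := (mem_univoque_iff (by linarith) ha1).1 hy
  exact ⟨(), _, ⟨c, mem_eventuallyWithin_of_unique ha ha1 hu, rfl⟩, by ring⟩

lemma dimH_image_val_le_univoque (h0 : 0 < a) (ha1 : a < 1) {ε : ℝ} (hε : 0 < ε)
    {Y : Set (ℕ → Bool)} (hY : Y ⊆ tailsWithin a (crit a - ε)) :
    dimH (val a '' Y) ≤ dimH (univoque (1 / a)) := by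
  refine dimH_le_of_subset_iUnion_affine (ι := Unit) (fun _ => -(a / (1 - a))) (fun _ => 2) ?_
  rintro _ ⟨c, hc, rfl⟩
  exact ⟨(), _, (mem_univoque_iff h0 ha1).2
    ⟨c, rfl, fun c' h => unique_of_mem_tailsWithin h0 ha1 hε (hY hc) h⟩, by ring⟩

lemma ofReal_div_le_of_forall_lt {δ L : ℝ} {D : ℝ≥0∞}
    (h : ∀ δ' < δ, ENNReal.ofReal (δ' / L) ≤ D) : ENNReal.ofReal (δ / L) ≤ D := by
  have ht : Tendsto (fun x => ENNReal.ofReal (x / L)) (𝓝[<] δ) (𝓝 (ENNReal.ofReal (δ / L))) :=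
    (ENNReal.continuous_ofReal.comp (continuous_id.div_const L)).continuousWithinAt
  exact le_of_tendsto ht (eventually_nhdsWithin_of_forall h)

theorem dimH_eq (ha : 1 / 2 < a) (ha1 : a < 1) (k : ℕ) :
    dimH {x ∈ Ioo (0 : ℝ) 1 | derivPInf (fun y => 1 * Mfun k a y) x}
        = ENNReal.ofReal (Real.log (1 / a) / Real.log 3) * dimH (univoque (1 / a)) ∧
      dimH {x ∈ Ioo (0 : ℝ) 1 | derivPInf (fun y => -1 * Mfun k a y) x}
        = ENNReal.ofReal (Real.log (1 / a) / Real.log 3) * dimH (univoque (1 / a)) := by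
  have h0 : 0 < a := by linarith
  obtain ⟨δ, hup, hlow⟩ := exists_entropy ha ha1 (crit_lt_one ha ha1)
  have hU : dimH (univoque (1 / a)) = ENNReal.ofReal (δ / -Real.log a) := by
    refine le_antisymm ((dimH_univoque_le ha ha1).trans (hup a h0 ha1)) ?_
    refine ofReal_div_le_of_forall_lt fun δ' hδ' => ?_
    obtain ⟨ε, hε, Y, hY, hdim⟩ := hlow δ' hδ'
    exact (hdim a (by simp)).trans (dimH_image_val_le_univoque h0 ha1 hε hY)
  have hup3 := hup (1 / 3) (by norm_num) (by norm_num)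
  have hD : ENNReal.ofReal (Real.log (1 / a) / Real.log 3) * dimH (univoque (1 / a))
      = ENNReal.ofReal (δ / -Real.log (1 / 3)) := by
    have hl : Real.log a < 0 := Real.log_neg h0 ha1
    have h3 : 0 < Real.log 3 := Real.log_pos (by norm_num)
    rw [hU, one_div, one_div, Real.log_inv, Real.log_inv, neg_neg,
      ← ENNReal.ofReal_mul (div_nonneg (by linarith) h3.le)]
    congr 1
    rw [mul_comm, div_mul_div_cancel₀ (neg_pos.2 hl).ne']
  rw [hD]
  constructor
  · refine le_antisymm ((dimH_setOf_derivPInf_le ha ha1 (by norm_num)).trans hup3) ?_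
    refine ofReal_div_le_of_forall_lt fun δ' hδ' => ?_
    obtain ⟨ε, hε, Y, hY, hdim⟩ := hlow δ' hδ'
    exact (hdim _ (by simp)).trans (dimH_image_val_le_derivPInf ha ha1 k hε hY)
  · refine le_antisymm ((dimH_setOf_derivPInf_le ha ha1 (by norm_num)).trans hup3) ?_
    refine ofReal_div_le_of_forall_lt fun δ' hδ' => ?_
    obtain ⟨ε, hε, Y, hY, hdim⟩ := hlow δ' hδ'
    exact (hdim _ (by simp)).trans (dimH_image_val_le_derivPInf_neg ha ha1 k hε hY)

end OkamotoFun

/-- for `k ≥ 1` and `1/2 < a < 1`, with `β = 1/a`,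
`dim_H D^{+∞}_{k,a} = dim_H D^{-∞}_{k,a} = (log β / log 3) · dim_H 𝒰_β`. -/
theorem stmt12 (k : ℕ) (hk : 1 ≤ k) (a : ℝ) (ha : 1/2 < a) (ha' : a < 1) :
    dimH {x ∈ Set.Ioo (0:ℝ) 1 | derivPInf (Mfun k a) x}
        = ENNReal.ofReal (Real.log (1 / a) / Real.log 3) * dimH (univoque (1 / a)) ∧
    dimH {x ∈ Set.Ioo (0:ℝ) 1 | derivMInf (Mfun k a) x}
        = ENNReal.ofReal (Real.log (1 / a) / Real.log 3) * dimH (univoque (1 / a)) := by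
  have h := OkamotoFun.dimH_eq ha ha' k
  simp only [one_mul, ← OkamotoFun.derivMInf_iff] at h
  exact h
end

section
/- Let φ := (1+√5)/2 be the golden ratio. For each k ≥ 1 and each a with 1/φ ≤ a < 1, the sets D^{+∞}_{k,a} and D^{−∞}_{k,a} are empty; that is, M_{k,a} does not have an infinite derivative (+∞ or −∞) at any point of (0,1). -/
open Filter Topology MeasureTheory Set
open scoped ENNReal

open scoped ContDiff

/-! ### Functions with nonnegative derivatives -/

/-- `f` is `C^k` at `a` and its derivatives at `a` up to order `k` are nonnegative. -/
def NonnegDerivs (k : ℕ) (f : ℝ → ℝ) (a : ℝ) : Prop :=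
  ContDiffAt ℝ k f a ∧ ∀ j ≤ k, 0 ≤ iteratedDeriv j f a

lemma NonnegDerivs.mul {k : ℕ} {f g : ℝ → ℝ} {a : ℝ} (hf : NonnegDerivs k f a)
    (hg : NonnegDerivs k g a) : NonnegDerivs k (fun b => f b * g b) a := by
  refine ⟨hf.1.mul hg.1, fun j hj => ?_⟩
  have hj' : (j : WithTop ℕ∞) ≤ k := by exact_mod_cast hj
  rw [iteratedDeriv_fun_mul (hf.1.of_le hj') (hg.1.of_le hj')]
  refine Finset.sum_nonneg fun i hi => ?_
  have hi' : i ≤ j := Nat.lt_succ_iff.1 (Finset.mem_range.1 hi)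
  have h₁ := hf.2 i (hi'.trans hj)
  have h₂ := hg.2 (j - i) ((Nat.sub_le _ _).trans hj)
  positivity

lemma nonnegDerivs_const (k : ℕ) {c : ℝ} (hc : 0 ≤ c) (a : ℝ) :
    NonnegDerivs k (fun _ => c) a := by
  refine ⟨contDiffAt_const, fun j _ => ?_⟩
  rw [iteratedDeriv_const]
  split_ifs <;> simp [hc]

lemma NonnegDerivs.pow {k : ℕ} {f : ℝ → ℝ} {a : ℝ} (hf : NonnegDerivs k f a) (n : ℕ) :
    NonnegDerivs k (fun b => f b ^ n) a := by
  induction n with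
  | zero => simp [nonnegDerivs_const k zero_le_one a]
  | succ n ih => simpa only [pow_succ] using ih.mul hf

lemma nonnegDerivs_id (k : ℕ) {a : ℝ} (ha : 0 ≤ a) : NonnegDerivs k (fun b => b) a := by
  refine ⟨contDiffAt_id, fun j _ => ?_⟩
  have h := iteratedDeriv_pow (𝕜 := ℝ) (x := a) 1 j
  simp only [pow_one] at h
  rw [h]
  positivity

lemma nonnegDerivs_two_mul_sub_one (k : ℕ) {a : ℝ} (ha : 1 / 2 ≤ a) :
    NonnegDerivs k (fun b => 2 * b - 1) a := by
  refine ⟨by fun_prop, fun j _ => ?_⟩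
  rcases j with _ | j
  · simp only [iteratedDeriv_zero]; linarith
  · have h : deriv (fun b : ℝ => 2 * b - 1) = fun _ => 2 := by
      funext b
      simp
    rw [iteratedDeriv_succ', h]
    exact (nonnegDerivs_const j zero_le_two a).2 j le_rfl

/-- `b ^ p * (1 - b)` has nonnegative derivatives at a fixed `a < 1` once `p` is large. -/
lemma nonnegDerivs_pow_mul_one_sub {k p : ℕ} {a : ℝ} (ha : 0 < a)
    (hp : (k : ℝ) ≤ (p + 1) * (1 - a)) : NonnegDerivs k (fun b => b ^ p * (1 - b)) a := by
  refine ⟨by fun_prop, fun j hj => ?_⟩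
  have hjk : (j : ℝ) ≤ k := by exact_mod_cast hj
  rcases Nat.eq_zero_or_pos j with rfl | hj0
  · rw [iteratedDeriv_zero]
    have : 0 ≤ 1 - a := by
      by_contra! h
      have : ((p : ℝ) + 1) * (1 - a) < 0 := mul_neg_of_pos_of_neg (by positivity) h
      have : (0 : ℝ) ≤ k := by positivity
      linarith
    positivity
  have hlt : j < p + 1 := by
    have : 0 < ((p : ℝ) + 1) * a := by positivity
    have : (j : ℝ) < (p + 1 : ℕ) := by push_cast; linarith
    exact_mod_cast this
  have hle : j ≤ p + 1 := hlt.le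
  have hfun : (fun b : ℝ => b ^ p * (1 - b)) = fun b => b ^ p - b ^ (p + 1) := by
    funext b; ring
  rw [hfun, iteratedDeriv_fun_sub (by fun_prop) (by fun_prop), iteratedDeriv_pow,
    iteratedDeriv_pow]
  have hjp : j ≤ p := Nat.lt_succ_iff.1 hlt
  have hs : p + 1 - j = (p - j) + 1 := by omega
  have hd : ((p : ℝ) + 1 - j) * (p + 1).descFactorial j = (p + 1) * p.descFactorial j := by
    have := Nat.succ_descFactorial p j
    have h : ((p + 1 - j : ℕ) : ℝ) = p + 1 - j := by push_cast [hle]; ring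
    rw [← h]
    exact_mod_cast this
  have hpos : (0 : ℝ) < p + 1 - j := by
    have : (j : ℝ) ≤ p := by exact_mod_cast hjp
    linarith
  rw [hs, pow_succ, sub_nonneg]
  have key : ((p + 1).descFactorial j : ℝ) * a ≤ p.descFactorial j := by
    rw [← mul_le_mul_iff_of_pos_left hpos, ← mul_assoc, hd]
    have : (0 : ℝ) ≤ p.descFactorial j := by positivity
    nlinarith
  calc ((p + 1).descFactorial j : ℝ) * (a ^ (p - j) * a)
      = ((p + 1).descFactorial j * a) * a ^ (p - j) := by ring
    _ ≤ _ := by gcongr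

lemma contDiffOn_and_iteratedDeriv_of_hasDerivAt {s : Set ℝ} (hs : IsOpen s) {f : ℕ → ℝ → ℝ}
    (hf : ∀ j, ∀ y ∈ s, HasDerivAt (f j) (f (j + 1) y) y) (n j : ℕ) :
    ContDiffOn ℝ n (f j) s ∧ ∀ y ∈ s, iteratedDeriv n (f j) y = f (j + n) y := by
  induction n generalizing j with
  | zero =>
    refine ⟨?_, fun y _ => by simp⟩
    have hcont : ContinuousOn (f j) s := fun y hy => (hf j y hy).continuousAt.continuousWithinAt
    simpa using hcont
  | succ n ih =>
    have hd : Set.EqOn (deriv (f j)) (f (j + 1)) s := fun y hy => (hf j y hy).deriv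
    constructor
    · push_cast
      rw [contDiffOn_succ_iff_deriv_of_isOpen hs]
      exact ⟨fun y hy => (hf j y hy).differentiableAt.differentiableWithinAt, by simp,
        (ih (j + 1)).1.congr hd⟩
    · intro y hy
      rw [iteratedDeriv_succ', (hd.eventuallyEq_of_mem (hs.mem_nhds hy)).iteratedDeriv_eq,
        (ih (j + 1)).2 y hy]
      congr 1; omega

/-- A power series with coefficients in `[0,1]` has nonnegative derivatives on `(0,1)`. -/
lemma nonnegDerivs_tsum (k : ℕ) {c : ℕ → ℝ} (hc : ∀ i, 0 ≤ c i) (hc' : ∀ i, c i ≤ 1) {a : ℝ}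
    (ha : a ∈ Set.Ioo (0 : ℝ) 1) : NonnegDerivs k (fun b => ∑' i, c i * b ^ i) a := by
  let f : ℕ → ℝ → ℝ := fun j b => ∑' i, c i * (i.descFactorial j * b ^ (i - j))
  have hsum : ∀ j : ℕ, ∀ r ∈ Set.Ioo (0 : ℝ) 1,
      Summable fun i : ℕ => (i.descFactorial j : ℝ) * r ^ (i - j) := fun j r hr => by
    rw [← summable_nat_add_iff j]
    simpa using summable_descFactorial_mul_geometric_of_norm_lt_one (R := ℝ) j (r := r)
      (by rw [Real.norm_eq_abs, abs_of_pos hr.1]; exact hr.2)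
  have hf : ∀ j, ∀ y ∈ Set.Ioo (0 : ℝ) 1, HasDerivAt (f j) (f (j + 1) y) y := by
    intro j y hy
    obtain ⟨r, hyr, hr⟩ := exists_between hy.2
    have hr' : r ∈ Set.Ioo (0 : ℝ) 1 := ⟨hy.1.trans hyr, hr⟩
    refine hasDerivAt_tsum_of_isPreconnected (t := Set.Ioo 0 r) (y₀ := y)
      (g' := fun i b => c i * (i.descFactorial (j + 1) * b ^ (i - (j + 1)))) (hsum (j + 1) r hr')
      isOpen_Ioo isPreconnected_Ioo (fun i z _ => ?_) (fun i z hz => ?_) ⟨hy.1, hyr⟩ ?_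
      ⟨hy.1, hyr⟩
    · convert! ((hasDerivAt_pow (i - j) z).const_mul (i.descFactorial j : ℝ)).const_mul (c i)
        using 1
      rw [Nat.descFactorial_succ, Nat.sub_sub]
      push_cast
      ring
    · have hz0 := hz.1.le
      have := hc i
      rw [Real.norm_eq_abs, abs_of_nonneg (by positivity)]
      calc c i * (i.descFactorial (j + 1) * z ^ (i - (j + 1)))
          ≤ 1 * (i.descFactorial (j + 1) * r ^ (i - (j + 1))) := by
            gcongr
            · exact hc' i
            · exact hz.2.le
        _ = _ := one_mul _
    · refine (hsum j y hy).of_nonneg_of_le (fun i => ?_) (fun i => ?_)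
      · have := hc i
        have := hy.1
        positivity
      · have := hy.1
        exact mul_le_of_le_one_left (by positivity) (hc' i)
  have h0 : (fun b => ∑' i, c i * b ^ i) = f 0 := by
    funext b; simp [f]
  rw [h0]
  refine ⟨(contDiffOn_and_iteratedDeriv_of_hasDerivAt isOpen_Ioo hf k 0).1.contDiffAt
    (isOpen_Ioo.mem_nhds ha), fun j _ => ?_⟩
  rw [(contDiffOn_and_iteratedDeriv_of_hasDerivAt isOpen_Ioo hf j 0).2 a ha]
  have := ha.1
  exact tsum_nonneg fun i => by have := hc i; positivity

lemma nonnegDerivs_sub_one {k : ℕ} {f : ℝ → ℝ} {a : ℝ} (hf : NonnegDerivs k f a)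
    (h1 : 1 ≤ f a) : NonnegDerivs k (fun b => f b - 1) a := by
  refine ⟨hf.1.sub contDiffAt_const, fun j hj => ?_⟩
  have hj' : (j : WithTop ℕ∞) ≤ k := by exact_mod_cast hj
  rw [iteratedDeriv_fun_sub (hf.1.of_le hj') contDiffAt_const, iteratedDeriv_const]
  split_ifs with h
  · subst h; simpa using h1
  · simpa using hf.2 j hj

/-! ### Ternary digits -/

lemma floor_three_mul_mem (y : ℝ) : 3 * ⌊y⌋ ≤ ⌊3 * y⌋ ∧ ⌊3 * y⌋ ≤ 3 * ⌊y⌋ + 2 := by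
  have h₁ := Int.floor_le y
  have h₂ := Int.lt_floor_add_one y
  constructor
  · rw [Int.le_floor]; push_cast; linarith
  · rw [← Int.lt_add_one_iff, Int.floor_lt]; push_cast; linarith

lemma tDigit_lt_three (x : ℝ) (n : ℕ) : tDigit x n < 3 := by
  unfold tDigit
  split_ifs
  · norm_num
  · have h := floor_three_mul_mem (3 ^ n * x)
    rw [← mul_assoc, ← pow_succ'] at h
    omega

lemma floor_pow_succ {x : ℝ} (hx : x ≠ 1) (n : ℕ) :
    ⌊(3 : ℝ) ^ (n + 1) * x⌋ = 3 * ⌊(3 : ℝ) ^ n * x⌋ + tDigit x n := by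
  have h := floor_three_mul_mem (3 ^ n * x)
  rw [← mul_assoc, ← pow_succ'] at h
  rw [tDigit, if_neg hx]
  omega

lemma three_mul_fract {x : ℝ} (hx : x ≠ 1) (n : ℕ) :
    3 * Int.fract ((3 : ℝ) ^ n * x) = tDigit x n + Int.fract ((3 : ℝ) ^ (n + 1) * x) := by
  have h : (⌊(3 : ℝ) ^ (n + 1) * x⌋ : ℝ) = 3 * ⌊(3 : ℝ) ^ n * x⌋ + tDigit x n := by
    exact_mod_cast floor_pow_succ hx n
  have h₁ := Int.floor_add_fract ((3 : ℝ) ^ n * x)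
  have h₂ := Int.floor_add_fract ((3 : ℝ) ^ (n + 1) * x)
  rw [pow_succ] at *
  linarith

lemma tDigit_affine_zero {t : ℝ} (ht : t ∈ Set.Ico (0 : ℝ) 1) {d : ℕ} (hd : d < 3) :
    tDigit ((d + t) / 3) 0 = d := by
  have hd' : (d : ℝ) ≤ 2 := by exact_mod_cast Nat.lt_succ_iff.1 hd
  have h1 : (d + t) / 3 ≠ 1 := by have := ht.2; intro h; linarith
  have h2 : ⌊(d + t) / 3⌋ = 0 := by
    rw [Int.floor_eq_zero_iff]
    exact ⟨by have := ht.1; positivity, by have := ht.2; linarith⟩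
  have h3 : ⌊(d : ℝ) + t⌋ = d := by
    rw [Int.floor_eq_iff]
    push_cast
    exact ⟨by linarith [ht.1], by linarith [ht.2]⟩
  have h4 : (3 : ℝ) ^ (0 + 1) * ((d + t) / 3) = d + t := by ring
  rw [tDigit, if_neg h1, h4, pow_zero, one_mul, h2, h3]
  simp

lemma tDigit_affine_succ {t : ℝ} (ht : t ∈ Set.Ico (0 : ℝ) 1) {d : ℕ} (hd : d < 3) (n : ℕ) :
    tDigit ((d + t) / 3) (n + 1) = tDigit t n := by
  have hd' : (d : ℝ) ≤ 2 := by exact_mod_cast Nat.lt_succ_iff.1 hd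
  have h1 : (d + t) / 3 ≠ 1 := by have := ht.2; intro h; linarith
  have h (m : ℕ) : ⌊(3 : ℝ) ^ (m + 1) * ((d + t) / 3)⌋ = 3 ^ m * d + ⌊3 ^ m * t⌋ := by
    rw [← Int.floor_intCast_add]
    congr 1
    push_cast
    ring
  rw [tDigit, if_neg h1, h, h, tDigit, if_neg ht.2.ne]
  congr 1
  ring

lemma lCount_succ (x : ℝ) (n : ℕ) :
    lCount x (n + 1) = lCount x n + if tDigit x n = 1 then 1 else 0 := by
  unfold lCount
  rw [Finset.range_add_one, Finset.filter_insert]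
  split_ifs with h
  · rw [Finset.card_insert_of_notMem (by simp)]
  · rfl

lemma lCount_le (x : ℝ) (n : ℕ) : lCount x n ≤ n := by
  simpa [lCount] using (Finset.card_filter_le (Finset.range n) fun i => tDigit x i = 1)

lemma lCount_affine {t : ℝ} (ht : t ∈ Set.Ico (0 : ℝ) 1) {d : ℕ} (hd : d < 3) (n : ℕ) :
    lCount ((d + t) / 3) (n + 1) = (if d = 1 then 1 else 0) + lCount t n := by
  induction n with
  | zero => rw [lCount_succ, tDigit_affine_zero ht hd]; simp [lCount]
  | succ n ih => rw [lCount_succ, ih, tDigit_affine_succ ht hd, lCount_succ t n, add_assoc]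

/-! ### Self-affinity of Okamoto's function -/

/-- The contraction ratio of the branch of `F_a` over the digit `d`. -/
noncomputable def ratioDig (a : ℝ) (d : ℕ) : ℝ := if d = 1 then 1 - 2 * a else a

/-- The signed increment of `F_a` over the triadic interval of level `n` containing `x`. -/
noncomputable def increment (x : ℝ) (n : ℕ) (b : ℝ) : ℝ :=
  b ^ (n - lCount x n) * (1 - 2 * b) ^ lCount x n

lemma increment_succ (x : ℝ) (n : ℕ) (b : ℝ) :
    increment x (n + 1) b = increment x n b * ratioDig b (tDigit x n) := by
  have h := lCount_le x n
  unfold increment ratioDig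
  rw [lCount_succ]
  split_ifs
  · rw [Nat.add_sub_add_right, pow_succ]; ring
  · rw [add_zero, Nat.succ_sub h, pow_succ]; ring

lemma increment_affine {t : ℝ} (ht : t ∈ Set.Ico (0 : ℝ) 1) {d : ℕ} (hd : d < 3) (n : ℕ)
    (b : ℝ) : increment ((d + t) / 3) (n + 1) b = ratioDig b d * increment t n b := by
  have h := lCount_le t n
  unfold increment ratioDig
  rw [lCount_affine ht hd]
  split_ifs
  · rw [add_comm 1, Nat.add_sub_add_right, pow_succ]; ring
  · rw [zero_add, Nat.succ_sub h, pow_succ]; ring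

lemma okamoto_eq (b x : ℝ) : Okamoto b x = ∑' n, increment x n b * qDig b (tDigit x n) := rfl

lemma abs_qDig_le {b : ℝ} (hb : b ∈ Set.Ioo (0 : ℝ) 1) (d : ℕ) : |qDig b d| ≤ 1 := by
  obtain ⟨h0, h1⟩ := hb
  unfold qDig
  split_ifs <;> rw [abs_le] <;> constructor <;> linarith

lemma summable_okamoto {b : ℝ} (hb : b ∈ Set.Ioo (0 : ℝ) 1) (x : ℝ) :
    Summable fun n => increment x n b * qDig b (tDigit x n) := by
  have hr0 : 0 ≤ max b |1 - 2 * b| := hb.1.le.trans (le_max_left _ _)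
  have hr1 : max b |1 - 2 * b| < 1 :=
    max_lt hb.2 (abs_lt.2 ⟨by linarith [hb.2], by linarith [hb.1]⟩)
  refine (summable_geometric_of_lt_one hr0 hr1).of_norm_bounded fun n => ?_
  have hl := lCount_le x n
  rw [Real.norm_eq_abs, increment, abs_mul, abs_mul, abs_pow, abs_pow, abs_of_pos hb.1]
  calc b ^ (n - lCount x n) * |1 - 2 * b| ^ lCount x n * |qDig b (tDigit x n)|
      ≤ max b |1 - 2 * b| ^ (n - lCount x n) * max b |1 - 2 * b| ^ lCount x n * 1 := by
        have := hb.1.le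
        gcongr
        · exact le_max_left _ _
        · exact le_max_right _ _
        · exact abs_qDig_le hb _
    _ = max b |1 - 2 * b| ^ n := by rw [mul_one, ← pow_add, Nat.sub_add_cancel hl]

lemma okamoto_zero (b : ℝ) : Okamoto b 0 = 0 := by
  have h (n : ℕ) : tDigit 0 n = 0 := by simp [tDigit]
  simp [Okamoto, h, qDig]

lemma okamoto_one {b : ℝ} (hb : b ∈ Set.Ioo (0 : ℝ) 1) : Okamoto b 1 = 1 := by
  have h (n : ℕ) : tDigit 1 n = 2 := by simp [tDigit]
  have hl (n : ℕ) : lCount 1 n = 0 := by simp [lCount, h]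
  have : 1 - b ≠ 0 := by linarith [hb.2]
  simp only [Okamoto, h, hl, qDig]
  norm_num
  rw [tsum_mul_right, tsum_geometric_of_lt_one hb.1.le hb.2, inv_mul_cancel₀ this]

lemma okamoto_affine_of_lt {b : ℝ} (hb : b ∈ Set.Ioo (0 : ℝ) 1) {t : ℝ}
    (ht : t ∈ Set.Ico (0 : ℝ) 1) {d : ℕ} (hd : d < 3) :
    Okamoto b ((d + t) / 3) = qDig b d + ratioDig b d * Okamoto b t := by
  rw [okamoto_eq, (summable_okamoto hb _).tsum_eq_zero_add, okamoto_eq, ← tsum_mul_left]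
  congr 1
  · rw [tDigit_affine_zero ht hd]; simp [increment, lCount]
  · refine tsum_congr fun n => ?_
    rw [increment_affine ht hd, tDigit_affine_succ ht hd, mul_assoc]

/-- The functional equation of `F_a`. -/
lemma okamoto_affine {b : ℝ} (hb : b ∈ Set.Ioo (0 : ℝ) 1) {t : ℝ}
    (ht : t ∈ Set.Icc (0 : ℝ) 1) {d : ℕ} (hd : d < 3) :
    Okamoto b ((d + t) / 3) = qDig b d + ratioDig b d * Okamoto b t := by
  obtain h1 | rfl := ht.2.lt_or_eq
  · exact okamoto_affine_of_lt hb ⟨ht.1, h1⟩ hd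
  rw [okamoto_one hb]
  have h0 : (0 : ℝ) ∈ Set.Ico (0 : ℝ) 1 := by simp
  interval_cases d
  · have := okamoto_affine_of_lt hb h0 (d := 1) (by norm_num)
    rw [okamoto_zero] at this
    norm_num [qDig, ratioDig] at this ⊢
    exact this
  · have := okamoto_affine_of_lt hb h0 (d := 2) (by norm_num)
    rw [okamoto_zero] at this
    norm_num [qDig, ratioDig] at this ⊢
    rw [this]; ring
  · norm_num [qDig, ratioDig, okamoto_one hb]

/-- The point of relative position `t` in the triadic interval of level `n` containing `x`. -/
noncomputable def cellPoint (x : ℝ) (n : ℕ) (t : ℝ) : ℝ := (⌊(3 : ℝ) ^ n * x⌋ + t) / 3 ^ n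

lemma cellPoint_fract (x : ℝ) (n : ℕ) : cellPoint x n (Int.fract (3 ^ n * x)) = x := by
  rw [cellPoint, Int.floor_add_fract]
  field_simp

lemma cellPoint_succ {x : ℝ} (hx : x ≠ 1) (n : ℕ) (t : ℝ) :
    cellPoint x (n + 1) t = cellPoint x n ((tDigit x n + t) / 3) := by
  rw [cellPoint, cellPoint, floor_pow_succ hx]
  push_cast
  field_simp
  ring

lemma cellPoint_mem {x : ℝ} (hx : x ∈ Set.Ico (0 : ℝ) 1) (n : ℕ) {t : ℝ}
    (ht : t ∈ Set.Icc (0 : ℝ) 1) : cellPoint x n t ∈ Set.Icc (0 : ℝ) 1 := by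
  have h3 : (0 : ℝ) < 3 ^ n := by positivity
  have h0 : (0 : ℤ) ≤ ⌊(3 : ℝ) ^ n * x⌋ := Int.floor_nonneg.2 (mul_nonneg h3.le hx.1)
  have h1 : ⌊(3 : ℝ) ^ n * x⌋ + 1 ≤ (3 : ℤ) ^ n := by
    rw [Int.add_one_le_iff, Int.floor_lt]
    push_cast
    exact mul_lt_of_lt_one_right h3 hx.2
  have h0' : (0 : ℝ) ≤ ⌊(3 : ℝ) ^ n * x⌋ := by exact_mod_cast h0
  have h1' : (⌊(3 : ℝ) ^ n * x⌋ : ℝ) + 1 ≤ 3 ^ n := by exact_mod_cast h1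
  rw [cellPoint]
  constructor
  · exact div_nonneg (add_nonneg h0' ht.1) h3.le
  · rw [div_le_one h3]; linarith [ht.2]

/-- `F_b` on a triadic cell is an affine copy of `F_b` on `[0,1]`. -/
lemma okamoto_cellPoint {x : ℝ} (hx : x ∈ Set.Ico (0 : ℝ) 1) (n : ℕ) {b : ℝ}
    (hb : b ∈ Set.Ioo (0 : ℝ) 1) {t : ℝ} (ht : t ∈ Set.Icc (0 : ℝ) 1) :
    Okamoto b (cellPoint x n t) =
      Okamoto b (cellPoint x n 0) + increment x n b * Okamoto b t := by
  induction n generalizing t with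
  | zero =>
    have h : ⌊x⌋ = 0 := Int.floor_eq_zero_iff.2 hx
    simp [cellPoint, increment, lCount, h, okamoto_zero]
  | succ n ih =>
    have hd := tDigit_lt_three x n
    have hd' : (tDigit x n : ℝ) ≤ 2 := by exact_mod_cast Nat.lt_succ_iff.1 hd
    have key {s : ℝ} (hs : s ∈ Set.Icc (0 : ℝ) 1) :
        Okamoto b (cellPoint x (n + 1) s) = Okamoto b (cellPoint x n 0) +
          increment x n b * (qDig b (tDigit x n) + ratioDig b (tDigit x n) * Okamoto b s) := by
      rw [cellPoint_succ hx.2.ne, ih, okamoto_affine hb hs hd]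
      exact ⟨by have := hs.1; positivity, by linarith [hs.2]⟩
    rw [key ht, key (s := 0) (by simp), okamoto_zero, increment_succ]
    ring

lemma contDiff_increment (x : ℝ) (n : ℕ) : ContDiff ℝ ∞ (increment x n) := by
  unfold increment; fun_prop

lemma contDiff_qDig (d : ℕ) : ContDiff ℝ ∞ fun b => qDig b d := by
  unfold qDig; split_ifs <;> fun_prop

lemma contDiffOn_okamoto_cellPoint_zero {x : ℝ} (hx : x ∈ Set.Ico (0 : ℝ) 1) (n : ℕ) :
    ContDiffOn ℝ ∞ (fun b => Okamoto b (cellPoint x n 0)) (Set.Ioo 0 1) := by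
  induction n with
  | zero =>
    have h : ⌊x⌋ = 0 := Int.floor_eq_zero_iff.2 hx
    simpa [cellPoint, h, okamoto_zero] using contDiffOn_const
  | succ n ih =>
    have hd := tDigit_lt_three x n
    have hd' : (tDigit x n : ℝ) ≤ 2 := by exact_mod_cast Nat.lt_succ_iff.1 hd
    refine (ih.add ((contDiff_increment x n).mul (contDiff_qDig (tDigit x n))).contDiffOn).congr
      fun b hb => ?_
    rw [cellPoint_succ hx.2.ne, okamoto_cellPoint hx n hb ⟨by positivity, by linarith⟩,
      okamoto_affine hb (by simp) hd, okamoto_zero]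
    ring

lemma cellPoint_strictMono (x : ℝ) (n : ℕ) : StrictMono (cellPoint x n) := fun s t h => by
  unfold cellPoint; gcongr

lemma cellPoint_sub_self (x : ℝ) (n : ℕ) (t : ℝ) :
    cellPoint x n t - x = (t - Int.fract (3 ^ n * x)) / 3 ^ n := by
  have h := Int.floor_add_fract ((3 : ℝ) ^ n * x)
  rw [cellPoint, eq_div_iff (by positivity), sub_mul, div_mul_cancel₀ _ (by positivity)]
  linarith

lemma tDigit_fract {x : ℝ} (hx : x ≠ 1) (n i : ℕ) :
    tDigit (Int.fract (3 ^ n * x)) i = tDigit x (n + i) := by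
  have h (m : ℕ) : ⌊(3 : ℝ) ^ m * Int.fract (3 ^ n * x)⌋ =
      ⌊(3 : ℝ) ^ (n + m) * x⌋ - 3 ^ m * ⌊(3 : ℝ) ^ n * x⌋ := by
    rw [← Int.floor_sub_intCast, Int.fract]
    congr 1
    push_cast
    ring
  rw [tDigit, if_neg (Int.fract_lt_one _).ne, h, h, tDigit, if_neg hx, ← add_assoc]
  congr 1
  ring

lemma okamoto_one_third_pow {b : ℝ} (hb : b ∈ Set.Ioo (0 : ℝ) 1) (m : ℕ) :
    Okamoto b ((1 / 3) ^ m) = b ^ m := by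
  induction m with
  | zero => simp [okamoto_one hb]
  | succ m ih =>
    have h : ((1 : ℝ) / 3) ^ (m + 1) = ((0 : ℕ) + (1 / 3) ^ m) / 3 := by push_cast; ring
    rw [h, okamoto_affine hb ⟨by positivity, pow_le_one₀ (by norm_num) (by norm_num)⟩
      (by norm_num), ih]
    simp [qDig, ratioDig, pow_succ']

lemma okamoto_one_sub_one_third_pow {b : ℝ} (hb : b ∈ Set.Ioo (0 : ℝ) 1) (m : ℕ) :
    Okamoto b (1 - (1 / 3) ^ m) = 1 - b ^ m := by
  induction m with
  | zero => simp [okamoto_zero]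
  | succ m ih =>
    have h : 1 - ((1 : ℝ) / 3) ^ (m + 1) = ((2 : ℕ) + (1 - (1 / 3) ^ m)) / 3 := by
      push_cast; ring
    have h1 : ((1 : ℝ) / 3) ^ m ≤ 1 := pow_le_one₀ (by norm_num) (by norm_num)
    have h0 : (0 : ℝ) < (1 / 3) ^ m := by positivity
    rw [h, okamoto_affine hb ⟨by linarith, by linarith⟩ (by norm_num), ih]
    norm_num [qDig, ratioDig]
    ring

lemma okamoto_natCast_div_three {b : ℝ} (hb : b ∈ Set.Ioo (0 : ℝ) 1) {d : ℕ} (hd : d < 3) :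
    Okamoto b (d / 3) = qDig b d := by
  simpa [okamoto_zero] using okamoto_affine hb (t := 0) (by simp) hd

/-! ### Increments of the derivatives in the parameter -/

/-- If `F_b(t) - F_b(s) = G(b)`, then the increment of `M_{k,a}` between the points of relative
positions `s` and `t` in a triadic cell is a `k`-th derivative. -/
lemma Mfun_cellPoint_sub {k : ℕ} {a x : ℝ} (ha : a ∈ Set.Ioo (0 : ℝ) 1)
    (hx : x ∈ Set.Ico (0 : ℝ) 1) (n : ℕ) {s t : ℝ} (hs : s ∈ Set.Icc (0 : ℝ) 1)
    (ht : t ∈ Set.Icc (0 : ℝ) 1) {f G : ℝ → ℝ} (hf : ContDiffAt ℝ k f a)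
    (hG : ContDiffAt ℝ k G a) (hsf : ∀ b ∈ Set.Ioo (0 : ℝ) 1, Okamoto b s = f b)
    (htG : ∀ b ∈ Set.Ioo (0 : ℝ) 1, Okamoto b t = f b + G b) :
    Mfun k a (cellPoint x n t) - Mfun k a (cellPoint x n s) =
      iteratedDeriv k (fun b => increment x n b * G b) a := by
  have hnhds : Set.Ioo (0 : ℝ) 1 ∈ 𝓝 a := isOpen_Ioo.mem_nhds ha
  have hk : (k : WithTop ℕ∞) ≤ (⊤ : ℕ∞) := by exact_mod_cast le_top
  have hinc : ContDiffAt ℝ k (increment x n) a := ((contDiff_increment x n).contDiffAt).of_le hk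
  have h0 : ContDiffAt ℝ k (fun b => Okamoto b (cellPoint x n 0)) a :=
    ((contDiffOn_okamoto_cellPoint_zero hx n).contDiffAt hnhds).of_le hk
  have hS : (fun b => Okamoto b (cellPoint x n s)) =ᶠ[𝓝 a]
      fun b => Okamoto b (cellPoint x n 0) + increment x n b * f b := by
    filter_upwards [hnhds] with b hb
    rw [okamoto_cellPoint hx n hb hs, hsf b hb]
  have hT : (fun b => Okamoto b (cellPoint x n t)) =ᶠ[𝓝 a]
      fun b => (Okamoto b (cellPoint x n 0) + increment x n b * f b) + increment x n b * G b := by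
    filter_upwards [hnhds] with b hb
    rw [okamoto_cellPoint hx n hb ht, htG b hb]
    ring
  rw [Mfun, Mfun, hS.iteratedDeriv_eq, hT.iteratedDeriv_eq,
    iteratedDeriv_fun_add (h0.add (hinc.mul hf)) (hinc.mul hG)]
  ring

/-- The absolute value of `increment x n` on `(1/2, 1)`. -/
noncomputable def absIncrement (x : ℝ) (n : ℕ) (b : ℝ) : ℝ :=
  b ^ (n - lCount x n) * (2 * b - 1) ^ lCount x n

lemma increment_eq (x : ℝ) (n : ℕ) (b : ℝ) :
    increment x n b = (-1) ^ lCount x n * absIncrement x n b := by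
  have h : 1 - 2 * b = -1 * (2 * b - 1) := by ring
  rw [increment, absIncrement, h, mul_pow]
  ring

lemma iteratedDeriv_increment_mul (k : ℕ) (a x : ℝ) (n : ℕ) (G : ℝ → ℝ) :
    iteratedDeriv k (fun b => increment x n b * G b) a =
      (-1) ^ lCount x n * iteratedDeriv k (fun b => absIncrement x n b * G b) a := by
  rw [← iteratedDeriv_const_mul_field]
  simp only [increment_eq, mul_assoc]

lemma nonnegDerivs_absIncrement (k : ℕ) {a : ℝ} (ha : 1 / 2 ≤ a) (x : ℝ) (n : ℕ) :
    NonnegDerivs k (absIncrement x n) a :=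
  ((nonnegDerivs_id k (by linarith)).pow _).mul ((nonnegDerivs_two_mul_sub_one k ha).pow _)

/-- `σ * f` is locally strictly increasing at `x`, relative to `[0,1]`. -/
def StrictIncrAt (σ : ℝ) (f : ℝ → ℝ) (x : ℝ) : Prop :=
  ∃ δ > 0, ∀ y ∈ Set.Icc (0 : ℝ) 1,
    (x < y → y < x + δ → 0 < σ * (f y - f x)) ∧ (y < x → x - δ < y → 0 < σ * (f x - f y))

lemma strictIncrAt_of_eventually {σ : ℝ} {f : ℝ → ℝ} {x : ℝ}
    (h : ∀ᶠ y in 𝓝[Set.Icc 0 1 \ {x}] x, 0 < σ * ((f y - f x) / (y - x))) :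
    StrictIncrAt σ f x := by
  rw [eventually_nhdsWithin_iff, Metric.eventually_nhds_iff] at h
  obtain ⟨δ, hδ, h⟩ := h
  refine ⟨δ, hδ, fun y hy => ⟨fun h₁ h₂ => ?_, fun h₁ h₂ => ?_⟩⟩
  · have := h (y := y) (by rw [Real.dist_eq, abs_lt]; constructor <;> linarith) ⟨hy, h₁.ne'⟩
    rw [← mul_div_assoc] at this
    exact (div_pos_iff_of_pos_right (sub_pos.2 h₁)).1 this
  · have := h (y := y) (by rw [Real.dist_eq, abs_lt]; constructor <;> linarith) ⟨hy, h₁.ne⟩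
    rw [← neg_sub x y, ← neg_sub (f x), neg_div_neg_eq, ← mul_div_assoc] at this
    exact (div_pos_iff_of_pos_right (sub_pos.2 h₁)).1 this

lemma derivPInf.strictIncrAt {f : ℝ → ℝ} {x : ℝ} (h : derivPInf f x) : StrictIncrAt 1 f x :=
  strictIncrAt_of_eventually <| by simpa using h.eventually_gt_atTop 0

lemma derivMInf.strictIncrAt {f : ℝ → ℝ} {x : ℝ} (h : derivMInf f x) : StrictIncrAt (-1) f x :=
  strictIncrAt_of_eventually <| by simpa using h.eventually_lt_atBot 0

lemma StrictIncrAt.cellPoint {σ : ℝ} {f : ℝ → ℝ} {x : ℝ} (hx : x ∈ Set.Ico (0 : ℝ) 1)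
    (h : StrictIncrAt σ f x) : ∃ N, ∀ n ≥ N, ∀ t ∈ Set.Icc (0 : ℝ) 1,
      (Int.fract (3 ^ n * x) < t → 0 < σ * (f (cellPoint x n t) - f x)) ∧
      (t < Int.fract (3 ^ n * x) → 0 < σ * (f x - f (cellPoint x n t))) := by
  obtain ⟨δ, hδ, h⟩ := h
  obtain ⟨N, hN⟩ := exists_pow_lt_of_lt_one hδ (show (1 / 3 : ℝ) < 1 by norm_num)
  refine ⟨N, fun n hn t ht => ?_⟩
  have hsmall : (1 / 3 : ℝ) ^ n < δ :=
    (pow_le_pow_of_le_one (by norm_num) (by norm_num) hn).trans_lt hN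
  have h0 := Int.fract_nonneg ((3 : ℝ) ^ n * x)
  have h1 := Int.fract_lt_one ((3 : ℝ) ^ n * x)
  have hp : (0 : ℝ) < 1 / 3 ^ n := by positivity
  have heq := cellPoint_sub_self x n t
  rw [div_eq_mul_one_div] at heq
  rw [div_pow, one_pow] at hsmall
  obtain ⟨hr, hl⟩ := h _ (cellPoint_mem hx n ht)
  refine ⟨fun hlt => hr ?_ ?_, fun hlt => hl ?_ ?_⟩
  · have := mul_pos (sub_pos.2 hlt) hp; linarith
  · nlinarith [ht.2]
  · have := mul_pos (sub_pos.2 hlt) hp; linarith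
  · nlinarith [ht.1]

/-! ### Points of infinite derivative have no digit `1` from some place on -/

section Obstruction

variable {k : ℕ} {a x σ : ℝ}

lemma sigma_eq_of_strictIncrAt (ha : 1 / 2 ≤ a) (ha' : a < 1) (hx : x ∈ Set.Ioo (0 : ℝ) 1)
    (hσ : σ = 1 ∨ σ = -1) (h : StrictIncrAt σ (Mfun k a) x) :
    ∃ N, ∀ n ≥ N, σ = (-1) ^ lCount x n := by
  have hx' : x ∈ Set.Ico (0 : ℝ) 1 := ⟨hx.1.le, hx.2⟩
  have ha01 : a ∈ Set.Ioo (0 : ℝ) 1 := ⟨by linarith, ha'⟩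
  obtain ⟨N, hN⟩ := h.cellPoint hx'
  refine ⟨N, fun n hn => ?_⟩
  have h1 := (hN n hn 1 (by simp)).1 (Int.fract_lt_one _)
  have h0 : 0 ≤ σ * (Mfun k a x - Mfun k a (cellPoint x n 0)) := by
    obtain h' | h' := (Int.fract_nonneg ((3 : ℝ) ^ n * x)).lt_or_eq
    · exact ((hN n hn 0 (by simp)).2 h').le
    · have := cellPoint_fract x n
      rw [← h'] at this
      simp [this]
  have hsub := Mfun_cellPoint_sub (k := k) ha01 hx' n (s := 0) (t := 1) (by simp) (by simp)
    (f := fun _ => 0) (G := fun _ => 1) contDiffAt_const contDiffAt_const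
    (fun b _ => okamoto_zero b) (fun b hb => by simp [okamoto_one hb])
  rw [iteratedDeriv_increment_mul] at hsub
  have hnn := ((nonnegDerivs_absIncrement k ha x n).mul
    (nonnegDerivs_const k zero_le_one a)).2 k le_rfl
  have hpos : 0 < σ * ((-1) ^ lCount x n *
      iteratedDeriv k (fun b => absIncrement x n b * 1) a) := by
    rw [← hsub]; linarith
  obtain hl | hl := neg_one_pow_eq_or ℝ (lCount x n) <;> rw [hl] at hpos ⊢ <;>
    rcases hσ with rfl | rfl <;> linarith

lemma tDigit_ne_one_of_sigma_eq {N : ℕ} (hN : ∀ n ≥ N, σ = (-1) ^ lCount x n) {n : ℕ}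
    (hn : N ≤ n) : tDigit x n ≠ 1 := fun hd => by
  have h₁ := hN n hn
  have h₂ := hN (n + 1) (by omega)
  rw [lCount_succ, if_pos hd, pow_succ] at h₂
  have h₃ : ((-1 : ℝ)) ^ lCount x n ≠ 0 := pow_ne_zero _ (by norm_num)
  apply h₃
  linarith

/-- Triadic points are excluded: the increments on the two sides have opposite signs. -/
lemma fract_ne_zero_of_strictIncrAt (ha : 1 / 2 ≤ a) (ha' : a < 1) (hx : x ∈ Set.Ioo (0 : ℝ) 1)
    (hσ : σ = 1 ∨ σ = -1) (h : StrictIncrAt σ (Mfun k a) x) (n : ℕ) :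
    Int.fract ((3 : ℝ) ^ n * x) ≠ 0 := by
  have hx' : x ∈ Set.Ico (0 : ℝ) 1 := ⟨hx.1.le, hx.2⟩
  have ha01 : a ∈ Set.Ioo (0 : ℝ) 1 := ⟨by linarith, ha'⟩
  induction n with
  | zero =>
    rw [pow_zero, one_mul, Int.fract_eq_self.2 hx']
    exact hx.1.ne'
  | succ q ih =>
    intro hq
    have hfr := three_mul_fract hx.2.ne q
    rw [hq, add_zero] at hfr
    have hd3 := tDigit_lt_three x q
    obtain ⟨d, hd⟩ : ∃ d, tDigit x q = d + 1 := Nat.exists_eq_succ_of_ne_zero fun h0 => by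
      rw [h0] at hfr
      exact ih (by push_cast at hfr; linarith)
    have hd1 : d < 2 := by omega
    have hd1' : (d : ℝ) ≤ 1 := by exact_mod_cast Nat.lt_succ_iff.1 hd1
    have hx_eq : x = cellPoint x q ((d + 1 : ℕ) / 3) := by
      conv_lhs => rw [← cellPoint_fract x q]
      congr 1
      rw [hd] at hfr
      linarith
    obtain ⟨δ, hδ, h⟩ := h
    obtain ⟨m, hm⟩ := exists_pow_lt_of_lt_one hδ (show (1 / 3 : ℝ) < 1 by norm_num)
    have he0 : (0 : ℝ) < (1 / 3) ^ m := by positivity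
    have he1 : (1 / 3 : ℝ) ^ m ≤ 1 := pow_le_one₀ (by norm_num) (by norm_num)
    set s : ℝ := ((d + 1 : ℕ) : ℝ) / 3 with hs
    set t₁ : ℝ := ((d + 1 : ℕ) + (1 / 3) ^ m) / 3 with ht₁
    set t₂ : ℝ := (d + (1 - (1 / 3) ^ m)) / 3 with ht₂
    have hd0 : (0 : ℝ) ≤ d := by positivity
    have hsI : s ∈ Set.Icc (0 : ℝ) 1 := by rw [hs]; push_cast; constructor <;> linarith
    have ht₁I : t₁ ∈ Set.Icc (0 : ℝ) 1 := by rw [ht₁]; push_cast; constructor <;> linarith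
    have ht₂I : t₂ ∈ Set.Icc (0 : ℝ) 1 := by rw [ht₂]; constructor <;> linarith
    have hst₁ : t₁ - s = (1 / 3) ^ m / 3 := by rw [ht₁, hs]; ring
    have hst₂ : s - t₂ = (1 / 3) ^ m / 3 := by rw [ht₂, hs]; push_cast; ring
    have hcell (t : ℝ) : cellPoint x q t - x = (t - s) / 3 ^ q := by
      rw [cellPoint_sub_self, show Int.fract ((3 : ℝ) ^ q * x) = s by rw [hd] at hfr; linarith]
    have h3 : (1 : ℝ) ≤ 3 ^ q := one_le_pow₀ (by norm_num)
    have hbd : (1 / 3 : ℝ) ^ m / 3 / 3 ^ q < δ :=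
      (div_le_self (by positivity) h3).trans_lt (by linarith)
    have hbd0 : 0 < (1 / 3 : ℝ) ^ m / 3 / 3 ^ q := by positivity
    have hr : 0 < σ * (Mfun k a (cellPoint x q t₁) - Mfun k a (cellPoint x q s)) := by
      have := hcell t₁
      rw [hst₁] at this
      rw [← hx_eq]
      exact (h _ (cellPoint_mem hx' q ht₁I)).1 (by linarith) (by linarith)
    have hl : 0 < σ * (Mfun k a (cellPoint x q s) - Mfun k a (cellPoint x q t₂)) := by
      have := hcell t₂
      rw [← neg_sub s, hst₂, neg_div] at this
      rw [← hx_eq]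
      exact (h _ (cellPoint_mem hx' q ht₂I)).2 (by linarith) (by linarith)
    have hq_smooth : ContDiffAt ℝ k (fun b => qDig b (d + 1)) a :=
      (contDiff_qDig (d + 1)).contDiffAt.of_le (by exact_mod_cast le_top)
    have hratio_smooth (c : ℕ) : ContDiffAt ℝ k (fun b => ratioDig b c * b ^ m) a := by
      unfold ratioDig; split_ifs <;> fun_prop
    have hfs (b : ℝ) (hb : b ∈ Set.Ioo (0 : ℝ) 1) : Okamoto b s = qDig b (d + 1) :=
      okamoto_natCast_div_three hb (by omega)
    rw [Mfun_cellPoint_sub ha01 hx' q hsI ht₁I hq_smooth (hratio_smooth (d + 1)) hfs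
      (fun b hb => by
        rw [ht₁, okamoto_affine hb ⟨he0.le, he1⟩ (by omega), okamoto_one_third_pow hb]),
      iteratedDeriv_increment_mul] at hr
    rw [← neg_sub, Mfun_cellPoint_sub ha01 hx' q hsI ht₂I hq_smooth (hratio_smooth d).neg hfs
      (fun b hb => by
        rw [ht₂, okamoto_affine hb ⟨by linarith, by linarith⟩ (by omega),
          okamoto_one_sub_one_third_pow hb]
        interval_cases d <;> norm_num [qDig, ratioDig] <;> ring),
      iteratedDeriv_increment_mul] at hl
    have hA := ((nonnegDerivs_absIncrement k ha x q).mul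
      ((nonnegDerivs_id k (by linarith)).mul ((nonnegDerivs_id k (by linarith)).pow m))).2 k le_rfl
    have hB := ((nonnegDerivs_absIncrement k ha x q).mul
      ((nonnegDerivs_two_mul_sub_one k ha).mul
        ((nonnegDerivs_id k (by linarith)).pow m))).2 k le_rfl
    have hflip : iteratedDeriv k (fun b => absIncrement x q b * ((1 - 2 * b) * b ^ m)) a =
        -iteratedDeriv k (fun b => absIncrement x q b * ((2 * b - 1) * b ^ m)) a := by
      rw [← iteratedDeriv_fun_neg]
      congr 1
      funext b
      ring
    simp only [mul_neg, iteratedDeriv_fun_neg] at hl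
    interval_cases d <;> norm_num [ratioDig] at hr hl <;> rw [hflip] at * <;>
      obtain hl' | hl' := neg_one_pow_eq_or ℝ (lCount x q) <;> rw [hl'] at hr hl <;>
      rcases hσ with rfl | rfl <;> linarith

end Obstruction

/-! ### Points with infinitely many digit changes -/

/-- For a sequence changing its value infinitely often and `a + a ^ 2 ≥ 1`, infinitely many tails weigh their disagreement with their first symbol at least `1`. -/
lemma exists_one_le_tsum_ne {a : ℝ} (ha : a ∈ Set.Ioo (0 : ℝ) 1) (ha' : 1 ≤ a + a ^ 2)
    {d : ℕ → ℕ} (hchange : ∀ M, ∃ n ≥ M, d n ≠ d (n + 1)) :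
    ∀ M, ∃ n ≥ M, 1 ≤ ∑' i, (if d (n + i) = d n then (0 : ℝ) else 1) * a ^ i := by
  intro M
  by_contra! hlt
  have ha0 := ha.1.le
  have hnn (n i : ℕ) : 0 ≤ (if d (n + i) = d n then (0 : ℝ) else 1) * a ^ i := by
    split_ifs <;> simp [ha0]
  have hsum (n : ℕ) : Summable fun i => (if d (n + i) = d n then (0 : ℝ) else 1) * a ^ i :=
    (summable_geometric_of_lt_one ha0 ha.2).of_nonneg_of_le (hnn n) fun i => by
      split_ifs <;> simp [ha0]
  obtain ⟨n, hn, hne⟩ := hchange M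
  have hstep (m : ℕ) (hm : M ≤ m) (hmne : d m ≠ d (m + 1)) : d (m + 2) = d m := by
    by_contra hcon
    have h₁ := (hsum m).sum_le_tsum (Finset.range 3) fun i _ => hnn m i
    have h₂ := hlt m (by omega)
    simp only [Finset.sum_range_succ, Finset.sum_range_zero, add_zero, if_pos, hcon,
      hmne.symm, if_false] at h₁
    linarith
  have halt (j : ℕ) : d (n + j) ≠ d (n + j + 1) := by
    induction j with
    | zero => exact hne
    | succ j ih =>
      have := hstep (n + j) (by omega) ih
      rw [show n + (j + 1) + 1 = n + j + 2 by ring, this]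
      exact ih.symm
  have hodd (j : ℕ) : d (n + (2 * j + 1)) ≠ d n := by
    induction j with
    | zero => exact hne.symm
    | succ j ih =>
      have := hstep (n + (2 * j + 1)) (by omega) (halt _)
      rwa [show n + (2 * (j + 1) + 1) = n + (2 * j + 1) + 2 by ring, this]
  have hinj : Function.Injective fun j : ℕ => 2 * j + 1 := fun i j h => by
    simp only at h; omega
  have hle := tsum_comp_le_tsum_of_inj (hsum n) (hnn n) hinj
  have hsq : a ^ 2 < 1 := by nlinarith [ha.1, ha.2]
  have heq : ∑' j : ℕ, ((fun i => (if d (n + i) = d n then (0 : ℝ) else 1) * a ^ i) ∘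
      fun j : ℕ => 2 * j + 1) j = a * (1 - a ^ 2)⁻¹ := by
    rw [← tsum_geometric_of_lt_one (sq_nonneg a) hsq, ← tsum_mul_left]
    refine tsum_congr fun j => ?_
    simp only [Function.comp_apply, if_neg (hodd j), pow_succ, pow_mul]
    ring
  have hge : 1 ≤ a * (1 - a ^ 2)⁻¹ := by
    rw [← div_eq_mul_inv, one_le_div (by linarith)]
    linarith
  have := hlt n (by omega)
  simp only [Function.comp_def] at heq hle
  linarith

/-- The ternary digits of a point which is not triadic are not eventually constant with value
`0` or `2`. -/
lemma tDigit_change {x : ℝ} (hx : x ≠ 1) (hfr : ∀ n : ℕ, Int.fract ((3 : ℝ) ^ n * x) ≠ 0) {N : ℕ}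
    (hd : ∀ n ≥ N, tDigit x n = 0 ∨ tDigit x n = 2) (M : ℕ) :
    ∃ n ≥ M, tDigit x n ≠ tDigit x (n + 1) := by
  by_contra! hcon
  set K := max M N with hK
  have hconst (j : ℕ) : tDigit x (K + j) = tDigit x K := by
    induction j with
    | zero => rfl
    | succ j ih => rw [← ih, ← add_assoc, hcon (K + j) (by omega)]
  obtain ⟨c, hc, hdc⟩ : ∃ c : ℝ, (c = 0 ∨ c = 1) ∧ (tDigit x K : ℝ) = 2 * c := by
    rcases hd K (by omega) with h | h <;> rw [h]
    · exact ⟨0, by simp, by simp⟩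
    · exact ⟨1, by simp, by simp⟩
  have hiter (j : ℕ) : Int.fract ((3 : ℝ) ^ (K + j) * x) - c =
      3 ^ j * (Int.fract (3 ^ K * x) - c) := by
    induction j with
    | zero => simp
    | succ j ih =>
      have h := three_mul_fract hx (K + j)
      rw [hconst, hdc] at h
      rw [pow_succ' (3 : ℝ) j, mul_assoc, ← ih, ← add_assoc]
      linarith
  have h0 := Int.fract_nonneg ((3 : ℝ) ^ K * x)
  have h1 := Int.fract_lt_one ((3 : ℝ) ^ K * x)
  have hne : Int.fract ((3 : ℝ) ^ K * x) - c ≠ 0 := by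
    rcases hc with rfl | rfl
    · simpa using hfr K
    · linarith
  obtain ⟨j, hj⟩ := pow_unbounded_of_one_lt |Int.fract ((3 : ℝ) ^ K * x) - c|⁻¹
    (show (1 : ℝ) < 3 by norm_num)
  have hbig : 1 < |Int.fract ((3 : ℝ) ^ (K + j) * x) - c| := by
    rw [hiter, abs_mul, abs_of_pos (by positivity : (0 : ℝ) < 3 ^ j)]
    rwa [inv_lt_iff_one_lt_mul₀ (abs_pos.2 hne)] at hj
  have h0' := Int.fract_nonneg ((3 : ℝ) ^ (K + j) * x)
  have h1' := Int.fract_lt_one ((3 : ℝ) ^ (K + j) * x)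
  rw [lt_abs] at hbig
  rcases hc with rfl | rfl <;> rcases hbig with h | h <;> linarith

/-- `F_b` at a point whose ternary digits are `0` or `2`. -/
lemma okamoto_of_tDigit_ne_one {b : ℝ} (hb : b ∈ Set.Ioo (0 : ℝ) 1) {t : ℝ}
    (ht : ∀ i, tDigit t i = 0 ∨ tDigit t i = 2) :
    Okamoto b t = if tDigit t 0 = 0
      then (1 - b) * ∑' i, (if tDigit t i = tDigit t 0 then (0 : ℝ) else 1) * b ^ i
      else 1 - (1 - b) * ∑' i, (if tDigit t i = tDigit t 0 then (0 : ℝ) else 1) * b ^ i := by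
  have hl (n : ℕ) : lCount t n = 0 := by
    rw [lCount, Finset.card_eq_zero, Finset.filter_eq_empty_iff]
    intro i _
    have := ht i
    omega
  have hne : 1 - b ≠ 0 := by linarith [hb.2]
  have hgeo := summable_geometric_of_lt_one hb.1.le hb.2
  have hsum : Summable fun i => (if tDigit t i = tDigit t 0 then (0 : ℝ) else 1) * b ^ i :=
    hgeo.of_nonneg_of_le (fun i => by split_ifs <;> simp [hb.1.le]) fun i => by
      split_ifs <;> simp [hb.1.le]
  rw [okamoto_eq]
  split_ifs with h0
  · rw [← tsum_mul_left]
    refine tsum_congr fun i => ?_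
    rw [increment, hl, h0]
    rcases ht i with h | h <;> norm_num [h, qDig]
    ring
  · have h2 : tDigit t 0 = 2 := (ht 0).resolve_left h0
    have h1 : (1 : ℝ) = (1 - b) * ∑' i : ℕ, b ^ i := by
      rw [tsum_geometric_of_lt_one hb.1.le hb.2, mul_inv_cancel₀ hne]
    refine Eq.trans ?_ (congrArg (· - (1 - b) * _) h1.symm)
    rw [← mul_sub, ← hgeo.tsum_sub hsum, ← tsum_mul_left]
    refine tsum_congr fun i => ?_
    rw [increment, hl, h2]
    rcases ht i with h | h <;> norm_num [h, qDig]
    ring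

lemma not_strictIncrAt_Mfun {k : ℕ} {a x σ : ℝ} (ha : 1 / 2 ≤ a) (hgold : 1 ≤ a + a ^ 2)
    (ha' : a < 1) (hx : x ∈ Set.Ioo (0 : ℝ) 1) (hσ : σ = 1 ∨ σ = -1) :
    ¬ StrictIncrAt σ (Mfun k a) x := by
  intro h
  have hx' : x ∈ Set.Ico (0 : ℝ) 1 := ⟨hx.1.le, hx.2⟩
  have ha01 : a ∈ Set.Ioo (0 : ℝ) 1 := ⟨by linarith, ha'⟩
  have hfr := fract_ne_zero_of_strictIncrAt ha ha' hx hσ h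
  obtain ⟨N, hN⟩ := sigma_eq_of_strictIncrAt ha ha' hx hσ h
  have hd (n : ℕ) (hn : n ≥ N) : tDigit x n = 0 ∨ tDigit x n = 2 := by
    have := tDigit_ne_one_of_sigma_eq hN hn
    have := tDigit_lt_three x n
    omega
  obtain ⟨N', hN'⟩ := h.cellPoint hx'
  obtain ⟨p, hp⟩ := exists_nat_gt ((k : ℝ) / (1 - a))
  rw [div_lt_iff₀ (by linarith)] at hp
  obtain ⟨n, hn, hT⟩ := exists_one_le_tsum_ne ha01 hgold (tDigit_change hx.2.ne hfr hd)
    (max N' (N + p))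
  have hnN : N ≤ n := by omega
  have hlconst (j : ℕ) : lCount x (N + j) = lCount x N := by
    induction j with
    | zero => rfl
    | succ j ih =>
      rw [← add_assoc, lCount_succ, ih, if_neg (tDigit_ne_one_of_sigma_eq hN (by omega))]
      rfl
  have hln : p ≤ n - lCount x n := by
    have := hlconst (n - N)
    rw [Nat.add_sub_cancel' hnN] at this
    have := lCount_le x N
    omega
  set t := Int.fract ((3 : ℝ) ^ n * x) with ht
  have htI : t ∈ Set.Icc (0 : ℝ) 1 := ⟨Int.fract_nonneg _, (Int.fract_lt_one _).le⟩
  have ht1 : t < 1 := Int.fract_lt_one _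
  have hcell : cellPoint x n t = x := cellPoint_fract x n
  have htd (i : ℕ) : tDigit t i = tDigit x (n + i) := tDigit_fract hx.2.ne n i
  set T : ℝ → ℝ := fun b => ∑' i, (if tDigit x (n + i) = tDigit x n then (0 : ℝ) else 1) * b ^ i
    with hTdef
  have hTnn : NonnegDerivs k T a :=
    nonnegDerivs_tsum k (fun i => by split_ifs <;> norm_num)
      (fun i => by split_ifs <;> norm_num) ha01
  have hoka (b : ℝ) (hb : b ∈ Set.Ioo (0 : ℝ) 1) :
      Okamoto b t = if tDigit x n = 0 then (1 - b) * T b else 1 - (1 - b) * T b := by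
    have := okamoto_of_tDigit_ne_one hb (t := t) fun i => by
      rw [htd]; exact hd _ (by omega)
    simpa only [htd, add_zero] using this
  have hpk : (k : ℝ) ≤ ((n - lCount x n : ℕ) + 1) * (1 - a) := by
    have : (p : ℝ) ≤ (n - lCount x n : ℕ) := by exact_mod_cast hln
    nlinarith
  have hnn := (((nonnegDerivs_pow_mul_one_sub ha01.1 hpk).mul
    ((nonnegDerivs_two_mul_sub_one k ha).pow (lCount x n))).mul
      (nonnegDerivs_sub_one hTnn hT)).2 k le_rfl
  have hnn' : 0 ≤ iteratedDeriv k
      (fun b => absIncrement x n b * ((1 - b) * (T b - 1))) a := by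
    convert! hnn using 2
    funext b
    rw [absIncrement]
    ring
  have hσn := hN n hnN
  have hσσ : σ * σ = 1 := by rcases hσ with rfl | rfl <;> norm_num
  have hfract := three_mul_fract hx.2.ne n
  have h0' := Int.fract_nonneg ((3 : ℝ) ^ (n + 1) * x)
  have h1' := Int.fract_lt_one ((3 : ℝ) ^ (n + 1) * x)
  have hTc := hTnn.1
  rcases hd n hnN with h0 | h2
  · have hst : t < 2 / 3 := by rw [h0] at hfract; push_cast at hfract; linarith
    have hs : (2 / 3 : ℝ) ∈ Set.Icc (0 : ℝ) 1 := by norm_num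
    have hpos := (hN' n (by omega) _ hs).1 hst
    have hsub := Mfun_cellPoint_sub (k := k) ha01 hx' n hs htI (f := fun b => 1 - b)
      (G := fun b => (1 - b) * (T b - 1)) (by fun_prop) (by fun_prop)
      (fun b hb => by
        have := okamoto_natCast_div_three hb (d := 2) (by norm_num)
        norm_num [qDig] at this; exact this)
      (fun b hb => by rw [hoka b hb, if_pos h0]; ring)
    rw [iteratedDeriv_increment_mul, hcell, ← hσn] at hsub
    rw [← neg_sub, hsub, mul_neg, ← mul_assoc, hσσ] at hpos
    linarith
  · have hst : 1 / 3 < t := by rw [h2] at hfract; push_cast at hfract; linarith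
    have hs : (1 / 3 : ℝ) ∈ Set.Icc (0 : ℝ) 1 := by norm_num
    have hpos := (hN' n (by omega) _ hs).2 hst
    have hsub := Mfun_cellPoint_sub (k := k) ha01 hx' n hs htI (f := fun b => b)
      (G := fun b => -((1 - b) * (T b - 1))) (by fun_prop) (by fun_prop)
      (fun b hb => by
        have := okamoto_natCast_div_three hb (d := 1) (by norm_num)
        norm_num [qDig] at this ⊢; exact this)
      (fun b hb => by rw [hoka b hb, if_neg (by omega)]; ring)
    simp only [iteratedDeriv_increment_mul, hcell, ← hσn, mul_neg, iteratedDeriv_fun_neg] at hsub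
    rw [hsub, mul_neg, ← mul_assoc, hσσ] at hpos
    linarith

/-- for `k ≥ 1` and `1/φ ≤ a < 1` (with `φ = (1+√5)/2` the golden ratio),
`M_{k,a}` has no infinite derivative at any point of `(0,1)`. -/
theorem stmt13 (k : ℕ) (hk : 1 ≤ k) (a : ℝ)
    (ha : 1 / ((1 + Real.sqrt 5) / 2) ≤ a) (ha' : a < 1)
    (x : ℝ) (hx : x ∈ Set.Ioo (0:ℝ) 1) :
    ¬ derivPInf (Mfun k a) x ∧ ¬ derivMInf (Mfun k a) x := by
  have h5 : Real.sqrt 5 ^ 2 = 5 := Real.sq_sqrt (by norm_num)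
  have h2 : 2 ≤ Real.sqrt 5 := Real.le_sqrt_of_sq_le (by norm_num)
  have heq : 1 / ((1 + Real.sqrt 5) / 2) = (Real.sqrt 5 - 1) / 2 := by
    rw [div_eq_iff (by positivity)]
    nlinarith
  rw [heq] at ha
  have hhalf : 1 / 2 ≤ a := by linarith
  have hgold : 1 ≤ a + a ^ 2 := by nlinarith
  exact ⟨fun h => not_strictIncrAt_Mfun hhalf hgold ha' hx (Or.inl rfl) h.strictIncrAt,
    fun h => not_strictIncrAt_Mfun hhalf hgold ha' hx (Or.inr rfl) h.strictIncrAt⟩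
end
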